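/- arXiv:math/0506516 — 9 statements merged into one kernel-verified Lean document; each statement's English description precedes it below -/
import Mathlib

section
/- Let (X,d) be a metric space and T : X → X be α-Hölder, i.e. there are constants K > 0 and α ∈ (0,1] such that d(T(u),T(v)) ≤ K·d(u,v)^α for all u,v ∈ X. Then for all x,y ∈ X the hitting-time indicators satisfy R̄(x,y) ≥ α·R̄(x,T(y)) and R_(x,y) ≥ α·R_(x,T(y)). -/
open Filter MeasureTheory Metric Set

/-- Hitting time of the ball `B(y,r)` by the orbit of `x` under `T`
    (`⊤` if the forward orbit never enters the ball). -/
noncomputable def hitTime {X : Type*} [MetricSpace X] (T : X → X) (x y : X) (r : ℝ) : ℕ∞ :=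
  sInf {n : ℕ∞ | ∃ k : ℕ, n = k ∧ 0 < k ∧ T^[k] x ∈ Metric.ball y r}

/-- The quantity `log τ_r(x,y) / (- log r)`, set to `⊤` when the hitting time is infinite. -/
noncomputable def hitQuot {X : Type*} [MetricSpace X] (T : X → X) (x y : X) (r : ℝ) : EReal :=
  if hitTime T x y r = ⊤ then (⊤ : EReal)
  else ((Real.log ((hitTime T x y r).toNat) / (-Real.log r) : ℝ) : EReal)

/-- Upper hitting-time indicator `R̄(x,y)`. -/
noncomputable def Rbar {X : Type*} [MetricSpace X] (T : X → X) (x y : X) : EReal :=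
  Filter.limsup (hitQuot T x y) (nhdsWithin 0 (Set.Ioi 0))

/-- Lower hitting-time indicator `R_(x,y)`. -/
noncomputable def Rlow {X : Type*} [MetricSpace X] (T : X → X) (x y : X) : EReal :=
  Filter.liminf (hitQuot T x y) (nhdsWithin 0 (Set.Ioi 0))

/-- Upper local dimension of `μ` at `x`. -/
noncomputable def upperLocalDim {X : Type*} [MetricSpace X] [MeasurableSpace X]
    (μ : MeasureTheory.Measure X) (x : X) : EReal :=
  Filter.limsup
    (fun r : ℝ => ((Real.log (μ (Metric.ball x r)).toReal / Real.log r : ℝ) : EReal))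
    (nhdsWithin 0 (Set.Ioi 0))

/-- Lower local dimension of `μ` at `x`. -/
noncomputable def lowerLocalDim {X : Type*} [MetricSpace X] [MeasurableSpace X]
    (μ : MeasureTheory.Measure X) (x : X) : EReal :=
  Filter.liminf
    (fun r : ℝ => ((Real.log (μ (Metric.ball x r)).toReal / Real.log r : ℝ) : EReal))
    (nhdsWithin 0 (Set.Ioi 0))

open scoped Topology

theorem exists_iterate_of_hitTime_ne_top {X : Type*} [MetricSpace X] {T : X → X} {x y : X} {r : ℝ}
    (h : hitTime T x y r ≠ ⊤) :
    ∃ k : ℕ, hitTime T x y r = k ∧ 0 < k ∧ T^[k] x ∈ Metric.ball y r := by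
  have hne : {n : ℕ∞ | ∃ k : ℕ, n = k ∧ 0 < k ∧ T^[k] x ∈ Metric.ball y r}.Nonempty := by
    by_contra hne
    rw [Set.not_nonempty_iff_eq_empty] at hne
    exact h (by rw [hitTime, hne, sInf_empty])
  exact csInf_mem hne

theorem hitTime_le_of_iterate_mem {X : Type*} [MetricSpace X] {T : X → X} {x y : X} {r : ℝ} {k : ℕ}
    (hk : 0 < k) (h : T^[k] x ∈ Metric.ball y r) : hitTime T x y r ≤ k :=
  sInf_le ⟨k, rfl, hk, h⟩

theorem hitTime_map_le_add_one {X : Type*} [MetricSpace X] {T : X → X} {K α : ℝ} (hK : 0 < K)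
    (hα : 0 < α) (hT : ∀ u v : X, dist (T u) (T v) ≤ K * dist u v ^ α) (x y : X) (r : ℝ) :
    hitTime T x (T y) (K * r ^ α) ≤ hitTime T x y r + 1 := by
  by_cases h : hitTime T x y r = ⊤
  · simp [h]
  obtain ⟨k, hk, -, hmem⟩ := exists_iterate_of_hitTime_ne_top h
  rw [hk]
  refine hitTime_le_of_iterate_mem (k := k + 1) k.succ_pos ?_
  rw [← Nat.succ_eq_add_one, Function.iterate_succ_apply']
  exact (hT _ _).trans_lt
    (mul_lt_mul_of_pos_left (Real.rpow_lt_rpow dist_nonneg hmem hα) hK)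

theorem hitQuot_map_le_of_hitQuot_lt {X : Type*} [MetricSpace X] {T : X → X} {K α : ℝ} (hK : 0 < K)
    (hα : 0 < α) (hT : ∀ u v : X, dist (T u) (T v) ≤ K * dist u v ^ α) (x y : X) {a b : ℝ}
    (hab : a < b) :
    ∀ᶠ r in 𝓝[>] (0 : ℝ),
      hitQuot T x y r < a → hitQuot T x (T y) (K * r ^ α) ≤ ((b / α : ℝ) : EReal) := by
  have hlog : Tendsto (fun r : ℝ => -Real.log r) (𝓝[>] 0) atTop :=
    tendsto_neg_atBot_atTop.comp Real.tendsto_log_nhdsGT_zero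
  filter_upwards [self_mem_nhdsWithin, hlog.eventually_gt_atTop 0,
    hlog.eventually_gt_atTop (Real.log K / α),
    hlog.eventually_gt_atTop ((Real.log 2 * α + b * Real.log K) / ((b - a) * α))]
    with r hr hpos hden hlarge hlt
  have hr : 0 < r := hr
  rw [div_lt_iff₀ hα] at hden
  rw [div_lt_iff₀ (mul_pos (sub_pos.2 hab) hα)] at hlarge
  have htop : hitTime T x y r ≠ ⊤ := by
    intro h
    simp [hitQuot, h] at hlt
  obtain ⟨k, hk, hk0, -⟩ := exists_iterate_of_hitTime_ne_top htop
  have hle := hitTime_map_le_add_one hK hα hT x y r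
  rw [hk] at hle
  have htop' : hitTime T x (T y) (K * r ^ α) ≠ ⊤ :=
    ne_top_of_le_ne_top (ENat.natCast_ne_top (k + 1)) hle
  obtain ⟨m, hm, hm0, -⟩ := exists_iterate_of_hitTime_ne_top htop'
  have hmk : m ≤ k + 1 := by rw [hm] at hle; exact_mod_cast hle
  rw [hitQuot, if_neg htop, hk, ENat.toNat_natCast, EReal.coe_lt_coe_iff] at hlt
  rw [hitQuot, if_neg htop', hm, ENat.toNat_natCast, EReal.coe_le_coe_iff]
  rw [div_lt_iff₀ hpos] at hlt
  have hlogm : Real.log m ≤ Real.log 2 + Real.log k := by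
    rw [← Real.log_mul two_ne_zero (by positivity)]
    refine Real.log_le_log (by positivity) ?_
    exact_mod_cast (by omega : m ≤ 2 * k)
  rw [Real.log_mul hK.ne' (by positivity), Real.log_rpow hr,
    div_le_div_iff₀ (by linarith) hα]
  nlinarith [mul_le_mul_of_nonneg_right hlogm hα.le, mul_lt_mul_of_pos_right hlt hα]

theorem tendsto_const_mul_rpow_nhdsGT_zero {c p : ℝ} (hc : 0 < c) (hp : 0 < p) :
    Tendsto (fun r : ℝ => c * r ^ p) (𝓝[>] 0) (𝓝[>] 0) := by
  refine tendsto_nhdsWithin_iff.2 ⟨?_, ?_⟩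
  · have h : Tendsto (fun r : ℝ => c * r ^ p) (𝓝 0) (𝓝 (c * 0 ^ p)) :=
      ((Real.continuousAt_rpow_const 0 p (Or.inr hp.le)).tendsto).const_mul c
    rw [Real.zero_rpow hp.ne', mul_zero] at h
    exact h.mono_left nhdsWithin_le_nhds
  · filter_upwards [self_mem_nhdsWithin] with r hr
    exact mul_pos hc (Real.rpow_pos_of_pos hr p)

theorem eventually_nhdsGT_zero_of_const_mul_rpow {c p : ℝ} (hc : 0 < c) (hp : 0 < p)
    {P : ℝ → Prop} (h : ∀ᶠ r in 𝓝[>] (0 : ℝ), P (c * r ^ p)) : ∀ᶠ r in 𝓝[>] (0 : ℝ), P r := by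
  have hinv := (tendsto_const_mul_rpow_nhdsGT_zero
    (Real.rpow_pos_of_pos (inv_pos.2 hc) p⁻¹) (inv_pos.2 hp)).eventually h
  filter_upwards [hinv, self_mem_nhdsWithin] with r hr hr0
  have hr0 : 0 < r := hr0
  rwa [← Real.mul_rpow (by positivity) hr0.le, Real.rpow_inv_rpow (by positivity) hp.ne',
    mul_inv_cancel_left₀ hc.ne'] at hr

theorem EReal.coe_mul_le_of_forall_lt {c : ℝ} (hc : 0 < c) {u v : EReal}
    (h : ∀ a b : ℝ, v < a → a < b → u ≤ ((b / c : ℝ) : EReal)) : (c : EReal) * u ≤ v := by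
  by_contra! hlt
  obtain ⟨a, hva, hau⟩ := EReal.lt_iff_exists_real_btwn.1 hlt
  obtain ⟨b, hab, hbu⟩ := EReal.lt_iff_exists_real_btwn.1 hau
  refine hbu.not_ge ?_
  calc (c : EReal) * u ≤ (c : EReal) * ((b / c : ℝ) : EReal) :=
        mul_le_mul_of_nonneg_left (h a b hva (EReal.coe_lt_coe_iff.1 hab))
          (EReal.coe_nonneg.2 hc.le)
    _ = b := by rw [← EReal.coe_mul, mul_div_cancel₀ b hc.ne']

/-- If `T` is `α`-Hölder then `R̄(x,y) ≥ α·R̄(x,T y)` and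
    `R_(x,y) ≥ α·R_(x,T y)`. -/
theorem hitting_indicators_holder {X : Type*} [MetricSpace X]
    (T : X → X) (K α : ℝ) (hK : 0 < K) (hα0 : 0 < α) (hα1 : α ≤ 1)
    (hHolder : ∀ u v : X, dist (T u) (T v) ≤ K * dist u v ^ α) (x y : X) :
    (α : EReal) * Rbar T x (T y) ≤ Rbar T x y ∧
      (α : EReal) * Rlow T x (T y) ≤ Rlow T x y := by
  refine ⟨EReal.coe_mul_le_of_forall_lt hα0 fun a b ha hab => ?_,
    EReal.coe_mul_le_of_forall_lt hα0 fun a b ha hab => ?_⟩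
  · refine limsup_le_of_le (h := eventually_nhdsGT_zero_of_const_mul_rpow hK hα0 ?_)
    filter_upwards [hitQuot_map_le_of_hitQuot_lt hK hα0 hHolder x y hab,
      eventually_lt_of_limsup_lt ha] with r hr hra
    exact hr hra
  · refine liminf_le_of_frequently_le' ?_
    refine (tendsto_const_mul_rpow_nhdsGT_zero hK hα0).frequently ?_
    exact (frequently_lt_of_liminf_lt (h := ha)).mp
      (hitQuot_map_le_of_hitQuot_lt hK hα0 hHolder x y hab)
end

section
/- Let (X,d) be a metric space, μ a finite Borel measure on X, T : X → X Borel measurable, and x ∈ X a point with μ(B(x,r)) > 0 for all r > 0. For r > 0 and n ∈ ℕ let SF_r^n(x) = {y ∈ X : T^k(y) ∉ B(x,r) for all 1 ≤ k ≤ n} be the set of points whose orbit does not enter B(x,r) during the first n steps. Assume that for every ε > 0 one has Σ_{n≥1} μ( SF_{2^{−n}}^{⌈μ(B(x,2^{−n}))^{−1−ε}⌉}(x) ) < ∞. Then for μ-almost every y ∈ X, R̄(y,x) ≤ d̄_μ(x) and R_(y,x) ≤ d_μ(x). -/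
open Filter MeasureTheory Metric Set

/-- The set of points whose orbit does not enter `B(x,r)` during the first `n` steps. -/
def SF {X : Type*} [MetricSpace X] (T : X → X) (x : X) (r : ℝ) (n : ℕ) : Set X :=
  {y | ∀ k : ℕ, 1 ≤ k → k ≤ n → T^[k] y ∉ Metric.ball x r}

/-- The number of the dyadic scale `2 ^ (-n)` just above `r`. -/
noncomputable def dyadicIndex (r : ℝ) : ℕ := ⌊-Real.log r / Real.log 2⌋₊

lemma tendsto_dyadicIndex : Tendsto dyadicIndex (nhdsWithin 0 (Ioi 0)) atTop := by
  refine tendsto_nat_floor_atTop.comp (Tendsto.atTop_div_const (Real.log_pos one_lt_two) ?_)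
  exact tendsto_neg_atBot_atTop.comp Real.tendsto_log_nhdsGT_zero

lemma dyadicIndex_mul_log_two_le {r : ℝ} (hr : r ∈ Ioo (0 : ℝ) 1) :
    dyadicIndex r * Real.log 2 ≤ -Real.log r := by
  have h2 : 0 < Real.log 2 := Real.log_pos one_lt_two
  have hl := Real.log_neg hr.1 hr.2
  rw [← le_div_iff₀ h2]
  exact Nat.floor_le (div_nonneg (by linarith) h2.le)

lemma neg_log_lt_dyadicIndex_mul_log_two (r : ℝ) :
    -Real.log r < (dyadicIndex r + 1) * Real.log 2 := by
  have h2 : 0 < Real.log 2 := Real.log_pos one_lt_two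
  rw [← div_lt_iff₀ h2]
  exact Nat.lt_floor_add_one _

lemma log_two_rpow (a : ℝ) : Real.log ((2 : ℝ) ^ a) = a * Real.log 2 :=
  Real.log_rpow two_pos a

lemma eventually_affine_le {a b c d : ℝ} (h : a < c) :
    ∀ᶠ n : ℕ in atTop, a * n + b ≤ c * n + d := by
  have : Tendsto (fun n : ℕ => (c - a) * (n : ℝ)) atTop atTop :=
    tendsto_natCast_atTop_atTop.const_mul_atTop (sub_pos.2 h)
  filter_upwards [this.eventually_ge_atTop (b - d)] with n hn
  linarith

section HittingTimes

variable {X : Type*} [MetricSpace X]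

lemma hitTime_le {T : X → X} {x y : X} {r : ℝ} {k : ℕ} (hk : 0 < k)
    (h : T^[k] x ∈ ball y r) : hitTime T x y r ≤ k :=
  sInf_le ⟨k, rfl, hk, h⟩

lemma hitQuot_le_of_log_le {T : X → X} {x y : X} {r : ℝ} {k : ℕ} (hr : r ∈ Ioo (0 : ℝ) 1)
    (hk : 0 < k) (h : T^[k] x ∈ ball y r) {D : ℝ}
    (hlog : Real.log k ≤ D * -Real.log r) : hitQuot T x y r ≤ D := by
  have hle := hitTime_le hk h
  have htop : hitTime T x y r ≠ ⊤ := ne_top_of_le_ne_top (ENat.natCast_ne_top k) hle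
  have hl := Real.log_neg hr.1 hr.2
  rw [hitQuot, if_neg htop, EReal.coe_le_coe_iff, div_le_iff₀ (by linarith)]
  have hle' : (hitTime T x y r).toNat ≤ k := by
    simpa using ENat.toNat_le_toNat hle (ENat.natCast_ne_top k)
  refine le_trans ?_ hlog
  rcases Nat.eq_zero_or_pos (hitTime T x y r).toNat with h0 | h0
  · simpa [h0] using Real.log_natCast_nonneg k
  · exact Real.log_le_log (by exact_mod_cast h0) (by exact_mod_cast hle')

/-- A ball of mass at least `2 ^ (-a)` whose waiting time is controlled by a power of its mass
is entered after at most about `2 ^ (s * a)` steps. -/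
lemma log_le_of_le_ceil_rpow {m s a : ℝ} {k : ℕ} (hm : 0 < m) (hs : 0 ≤ s) (ha : 0 ≤ a)
    (hk : 0 < k) (hkm : k ≤ ⌈m ^ (-s)⌉₊) (hma : -(a * Real.log 2) ≤ Real.log m) :
    Real.log k ≤ (1 + s * a) * Real.log 2 := by
  have h1 : m ^ (-s) ≤ (2 : ℝ) ^ (s * a) := by
    rw [← Real.log_le_log_iff (Real.rpow_pos_of_pos hm _) (by positivity), Real.log_rpow hm,
      log_two_rpow]
    nlinarith
  have h2 : (1 : ℝ) ≤ (2 : ℝ) ^ (s * a) := Real.one_le_rpow one_le_two (mul_nonneg hs ha)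
  have h3 : (k : ℝ) ≤ (2 : ℝ) ^ (1 + s * a) := by
    rw [Real.rpow_add two_pos, Real.rpow_one]
    have := (Nat.ceil_lt_add_one (Real.rpow_nonneg hm.le (-s))).le
    have hkm' : (k : ℝ) ≤ (⌈m ^ (-s)⌉₊ : ℕ) := by exact_mod_cast hkm
    linarith
  rw [← log_two_rpow]
  exact Real.log_le_log (by exact_mod_cast hk) h3

lemma exists_hit_of_notMem_SF {T : X → X} {x y : X} {r : ℝ} {n : ℕ} (h : y ∉ SF T x r n) :
    ∃ k, 0 < k ∧ k ≤ n ∧ T^[k] y ∈ ball x r := by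
  simp only [SF, mem_ofPred_eq, not_forall, not_not] at h
  obtain ⟨k, h1, h2, h3⟩ := h
  exact ⟨k, h1, h2, h3⟩

variable [MeasurableSpace X] {x : X}

lemma lowerLocalDim_le_upperLocalDim {μ : Measure X} : lowerLocalDim μ x ≤ upperLocalDim μ x :=
  liminf_le_limsup

variable {μ : Measure X} [IsFiniteMeasure μ]

lemma log_measure_ball_mono (hx : ∀ r : ℝ, 0 < r → 0 < μ (ball x r)) {r s : ℝ} (hr : 0 < r)
    (h : r ≤ s) : Real.log (μ (ball x r)).toReal ≤ Real.log (μ (ball x s)).toReal :=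
  Real.log_le_log (ENNReal.toReal_pos (hx r hr).ne' (measure_ne_top _ _))
    (ENNReal.toReal_mono (measure_ne_top _ _) (measure_mono (ball_subset_ball h)))

lemma lowerLocalDim_nonneg (hx : ∀ r : ℝ, 0 < r → 0 < μ (ball x r)) :
    0 ≤ lowerLocalDim μ x := by
  refine EReal.ge_of_forall_gt_iff_ge.1 fun c hc => ?_
  have hc0 : c < 0 := by exact_mod_cast hc
  refine le_liminf_of_le (by isBoundedDefault) ?_
  set C := Real.log (μ univ).toReal
  have hlog : ∀ᶠ r : ℝ in nhdsWithin 0 (Ioi 0), Real.log r ≤ C / c :=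
    Real.tendsto_log_nhdsGT_zero.eventually_le_atBot _
  filter_upwards [hlog, Ioo_mem_nhdsGT (zero_lt_one' ℝ)] with r h1 hr
  have hl := Real.log_neg hr.1 hr.2
  rw [EReal.coe_le_coe_iff, le_div_iff_of_neg hl]
  have hC : Real.log (μ (ball x r)).toReal ≤ C :=
    Real.log_le_log (ENNReal.toReal_pos (hx r hr.1).ne' (measure_ne_top _ _))
      (ENNReal.toReal_mono (measure_ne_top _ _) (measure_mono (subset_univ _)))
  rw [le_div_iff_of_neg hc0] at h1
  linarith

lemma mul_log_lt_of_coe_div_lt {m r D : ℝ} (hr : r ∈ Ioo (0 : ℝ) 1)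
    (h : ((Real.log m / Real.log r : ℝ) : EReal) < D) : D * Real.log r < Real.log m := by
  rwa [EReal.coe_lt_coe_iff, div_lt_iff_of_neg (Real.log_neg hr.1 hr.2)] at h

/-- If the waiting times at dyadic scales are eventually controlled by powers of the masses with
exponents arbitrarily close to `-1`, then the mass exponent `D` bounds the hitting quotients up
to an arbitrarily small loss. -/
lemma eventually_hitQuot_le {T : X → X} {y : X} (hx : ∀ r : ℝ, 0 < r → 0 < μ (ball x r))
    (hy : ∀ j : ℕ, ∀ᶠ n : ℕ in atTop, y ∉ SF T x ((2 : ℝ) ^ (-((n : ℝ) + 1)))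
      (⌈((μ (ball x ((2 : ℝ) ^ (-((n : ℝ) + 1))))).toReal) ^ (-(1 + 1 / ((j : ℝ) + 1)))⌉₊))
    {D D' : ℝ} (hD : 0 < D) (hDD' : D < D') :
    ∀ᶠ n : ℕ in atTop, -(D * (n + 2) * Real.log 2) ≤
        Real.log (μ (ball x ((2 : ℝ) ^ (-((n : ℝ) + 1))))).toReal →
      ∀ r ∈ Ioo (0 : ℝ) 1, (2 : ℝ) ^ (-((n : ℝ) + 1)) ≤ r → n * Real.log 2 ≤ -Real.log r →
        hitQuot T y x r ≤ D' := by
  obtain ⟨j, hj⟩ := exists_nat_one_div_lt (sub_pos.2 ((one_lt_div hD).2 hDD'))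
  set s : ℝ := 1 + 1 / ((j : ℝ) + 1) with hs
  have hs0 : 0 ≤ s := by positivity
  have hsD : s * D < D' := by
    rw [← lt_div_iff₀ hD]; linarith
  filter_upwards [hy j, eventually_affine_le (b := 1 + s * D * 2) (d := 0) hsD]
    with n hn hlin hm r hr hr1 hr2
  obtain ⟨k, hk0, hk, hkmem⟩ := exists_hit_of_notMem_SF hn
  refine hitQuot_le_of_log_le hr hk0 (ball_subset_ball hr1 hkmem) ?_
  have hpos : 0 < (μ (ball x ((2 : ℝ) ^ (-((n : ℝ) + 1))))).toReal :=
    ENNReal.toReal_pos (hx _ (by positivity)).ne' (measure_ne_top _ _)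
  calc Real.log k ≤ (1 + s * (D * (n + 2))) * Real.log 2 :=
        log_le_of_le_ceil_rpow hpos hs0 (by positivity) hk0 hk hm
    _ ≤ D' * n * Real.log 2 := by
        gcongr
        linarith
    _ ≤ D' * -Real.log r := by
        rw [mul_assoc]
        exact mul_le_mul_of_nonneg_left hr2 (hD.trans hDD').le

lemma tendsto_two_rpow_neg_succ :
    Tendsto (fun n : ℕ => (2 : ℝ) ^ (-((n : ℝ) + 1))) atTop (nhdsWithin 0 (Ioi 0)) := by
  refine tendsto_nhdsWithin_iff.2 ⟨?_, Eventually.of_forall fun n => ?_⟩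
  · exact (tendsto_rpow_atBot_of_base_gt_one 2 one_lt_two).comp
      (tendsto_neg_atTop_atBot.comp
        (tendsto_atTop_add_const_right _ _ tendsto_natCast_atTop_atTop))
  · exact Real.rpow_pos_of_pos two_pos _

lemma Rbar_le_upperLocalDim {T : X → X} {y : X} (hx : ∀ r : ℝ, 0 < r → 0 < μ (ball x r))
    (hy : ∀ j : ℕ, ∀ᶠ n : ℕ in atTop, y ∉ SF T x ((2 : ℝ) ^ (-((n : ℝ) + 1)))
      (⌈((μ (ball x ((2 : ℝ) ^ (-((n : ℝ) + 1))))).toReal) ^ (-(1 + 1 / ((j : ℝ) + 1)))⌉₊)) :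
    Rbar T y x ≤ upperLocalDim μ x := by
  refine EReal.le_of_forall_lt_iff_le.1 fun D' hD' => ?_
  obtain ⟨D, hD, hDD'⟩ := EReal.lt_iff_exists_real_btwn.1 hD'
  have hD0 : 0 < D := by
    exact_mod_cast ((lowerLocalDim_nonneg hx).trans lowerLocalDim_le_upperLocalDim).trans_lt hD
  have hmass := tendsto_two_rpow_neg_succ.eventually
    ((eventually_lt_of_limsup_lt hD).and (Ioo_mem_nhdsGT (zero_lt_one' ℝ)))
  have hev := tendsto_dyadicIndex.eventually
    (hmass.and (eventually_hitQuot_le hx hy hD0 (by exact_mod_cast hDD')))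
  refine limsup_le_of_le (by isBoundedDefault) ?_
  filter_upwards [hev, Ioo_mem_nhdsGT (zero_lt_one' ℝ)] with r ⟨⟨h1, h2⟩, h3⟩ hr
  have hl2 : 0 < Real.log 2 := Real.log_pos one_lt_two
  refine h3 ?_ r hr ?_ (dyadicIndex_mul_log_two_le hr)
  · have h4 := mul_log_lt_of_coe_div_lt h2 h1
    rw [log_two_rpow] at h4
    nlinarith [mul_pos hD0 hl2]
  · rw [← Real.log_le_log_iff (by positivity) hr.1, log_two_rpow]
    linarith [neg_log_lt_dyadicIndex_mul_log_two r]

lemma Rlow_le_lowerLocalDim {T : X → X} {y : X} (hx : ∀ r : ℝ, 0 < r → 0 < μ (ball x r))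
    (hy : ∀ j : ℕ, ∀ᶠ n : ℕ in atTop, y ∉ SF T x ((2 : ℝ) ^ (-((n : ℝ) + 1)))
      (⌈((μ (ball x ((2 : ℝ) ^ (-((n : ℝ) + 1))))).toReal) ^ (-(1 + 1 / ((j : ℝ) + 1)))⌉₊)) :
    Rlow T y x ≤ lowerLocalDim μ x := by
  refine EReal.le_of_forall_lt_iff_le.1 fun D' hD' => ?_
  obtain ⟨D, hD, hDD'⟩ := EReal.lt_iff_exists_real_btwn.1 hD'
  have hD0 : 0 < D := by exact_mod_cast (lowerLocalDim_nonneg hx).trans_lt hD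
  have hidx : Tendsto (fun r => dyadicIndex r - 1) (nhdsWithin 0 (Ioi 0)) atTop :=
    (tendsto_sub_atTop_nat 1).comp tendsto_dyadicIndex
  have hev := hidx.eventually ((tendsto_two_rpow_neg_succ.eventually
    (Ioo_mem_nhdsGT (zero_lt_one' ℝ))).and
    (eventually_hitQuot_le hx hy hD0 (by exact_mod_cast hDD')))
  refine liminf_le_of_frequently_le ?_ (by isBoundedDefault)
  refine (tendsto_two_rpow_neg_succ.comp hidx).frequently ?_
  refine (frequently_lt_of_liminf_lt (by isBoundedDefault) hD).mp ?_
  filter_upwards [hev, tendsto_dyadicIndex.eventually_ge_atTop 1,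
    Ioo_mem_nhdsGT (zero_lt_one' ℝ)] with r ⟨h1, h2⟩ hn hr hlt
  have hl2 : 0 < Real.log 2 := Real.log_pos one_lt_two
  have hcast : ((dyadicIndex r - 1 : ℕ) : ℝ) = dyadicIndex r - 1 := by simp [Nat.cast_sub hn]
  refine h2 ?_ _ h1 le_rfl ?_
  · have hle : r ≤ (2 : ℝ) ^ (-(((dyadicIndex r - 1 : ℕ) : ℝ) + 1)) := by
      rw [← Real.log_le_log_iff hr.1 (by positivity), log_two_rpow, hcast]
      linarith [dyadicIndex_mul_log_two_le hr]
    refine le_trans ?_ ((mul_log_lt_of_coe_div_lt hr hlt).le.trans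
      (log_measure_ball_mono hx hr.1 hle))
    rw [hcast]
    nlinarith [neg_log_lt_dyadicIndex_mul_log_two r]
  · rw [Function.comp_apply, log_two_rpow]
    linarith

end HittingTimes

/-- Borel–Cantelli criterion bounding the hitting-time indicators by the
    local dimensions. -/
theorem hitting_le_dim_of_summable_SF {X : Type*} [MetricSpace X] [MeasurableSpace X]
    [BorelSpace X] (μ : MeasureTheory.Measure X) [IsFiniteMeasure μ]
    (T : X → X) (hT : Measurable T) (x : X)
    (hx : ∀ r : ℝ, 0 < r → 0 < μ (Metric.ball x r))
    (hsum : ∀ ε : ℝ, 0 < ε →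
      (∑' n : ℕ, μ (SF T x ((2:ℝ) ^ (-((n:ℝ) + 1)))
        (⌈((μ (Metric.ball x ((2:ℝ) ^ (-((n:ℝ) + 1))))).toReal) ^ (-(1 + ε))⌉₊))) < ⊤) :
    ∀ᵐ y ∂μ, Rbar T y x ≤ upperLocalDim μ x ∧ Rlow T y x ≤ lowerLocalDim μ x := by
  have hae : ∀ᵐ y ∂μ, ∀ j : ℕ, ∀ᶠ n : ℕ in atTop, y ∉ SF T x ((2 : ℝ) ^ (-((n : ℝ) + 1)))
      (⌈((μ (ball x ((2 : ℝ) ^ (-((n : ℝ) + 1))))).toReal) ^ (-(1 + 1 / ((j : ℝ) + 1)))⌉₊) :=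
    ae_all_iff.2 fun j => ae_eventually_notMem (hsum _ (by positivity)).ne
  filter_upwards [hae] with y hy
  exact ⟨Rbar_le_upperLocalDim hx hy, Rlow_le_lowerLocalDim hx hy⟩
end

section
/- Let 0 < m < 1 and define s_n = (2n+1)/(n²(n+1)²) for n ≥ 1 (so that s_n = 1/n² − 1/(n+1)²). Define the sequence (a_n) by a_0 = m² and a_n = a_{n−1}·m + s_n for n ≥ 1. Then for every n ≥ 2, a_n ≤ m^{⌊n/2⌋}/(1−m) + 4/n². -/
/-- Unfolding the recursion `j` times from index `k`: the increments telescope. -/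
theorem le_pow_mul_add_of_recursion {m : ℝ} (hm0 : 0 ≤ m) (hm1 : m ≤ 1) {a : ℕ → ℝ}
    (harec : ∀ n : ℕ, 1 ≤ n →
      a n = a (n - 1) * m + (2 * (n : ℝ) + 1) / ((n : ℝ) ^ 2 * ((n : ℝ) + 1) ^ 2))
    (k j : ℕ) :
    a (k + j) ≤ m ^ j * a k + (1 / ((k : ℝ) + 1) ^ 2 - 1 / ((k : ℝ) + j + 1) ^ 2) := by
  induction j with
  | zero => simp
  | succ j ih =>
    have hD : 0 ≤ 1 / ((k : ℝ) + 1) ^ 2 - 1 / ((k : ℝ) + j + 1) ^ 2 := by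
      rw [sub_nonneg]
      gcongr
      linarith [Nat.cast_nonneg (α := ℝ) j]
    have hs : (2 * ((k : ℝ) + j + 1) + 1) / (((k : ℝ) + j + 1) ^ 2 * ((k : ℝ) + j + 1 + 1) ^ 2)
        = 1 / ((k : ℝ) + j + 1) ^ 2 - 1 / ((k : ℝ) + j + 1 + 1) ^ 2 := by
      field_simp
      ring
    have hrec := harec (k + j + 1) (by omega)
    rw [Nat.add_sub_cancel] at hrec
    push_cast at hrec ⊢
    rw [hs] at hrec
    rw [← add_assoc k, hrec, pow_succ m j, ← add_assoc (k : ℝ)]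
    have h1 := mul_le_mul_of_nonneg_right ih hm0
    have h2 := mul_le_of_le_one_right hD hm1
    linarith

/-- the recursive sequence `a_n = a_{n-1} m + s_n`, `a_0 = m²`,
    with `s_n = (2n+1)/(n²(n+1)²)`, satisfies `a_n ≤ m^⌊n/2⌋/(1-m) + 4/n²` for `n ≥ 2`. -/
theorem sequence_bound (m : ℝ) (hm0 : 0 < m) (hm1 : m < 1) (a : ℕ → ℝ)
    (ha0 : a 0 = m ^ 2)
    (harec : ∀ n : ℕ, 1 ≤ n →
      a n = a (n - 1) * m + (2 * (n : ℝ) + 1) / ((n : ℝ) ^ 2 * ((n : ℝ) + 1) ^ 2)) :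
    ∀ n : ℕ, 2 ≤ n → a n ≤ m ^ (n / 2) / (1 - m) + 4 / (n : ℝ) ^ 2 := by
  intro n hn
  have h1m : 0 < 1 - m := sub_pos.mpr hm1
  have hunif (k : ℕ) : a k ≤ 1 / (1 - m) := by
    have h := le_pow_mul_add_of_recursion hm0.le hm1.le harec 0 k
    rw [ha0, zero_add] at h
    have hpow : m ^ k * m ^ 2 ≤ m ^ 2 :=
      mul_le_of_le_one_left (sq_nonneg m) (pow_le_one₀ hm0.le hm1.le)
    have hinv : 0 ≤ 1 / (((0 : ℕ) : ℝ) + k + 1) ^ 2 := by positivity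
    have hbase : 1 / (((0 : ℕ) : ℝ) + 1) ^ 2 = 1 := by norm_num
    have hgeom : 1 + m ^ 2 ≤ 1 / (1 - m) := by
      rw [le_div_iff₀ h1m]
      nlinarith [mul_pos hm0 h1m, pow_pos hm0 3]
    linarith
  have h := le_pow_mul_add_of_recursion hm0.le hm1.le harec (n - n / 2) (n / 2)
  rw [Nat.sub_add_cancel (Nat.div_le_self n 2)] at h
  have hhead : m ^ (n / 2) * a (n - n / 2) ≤ m ^ (n / 2) / (1 - m) := by
    rw [← mul_one_div]
    exact mul_le_mul_of_nonneg_left (hunif _) (by positivity)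
  have htail : 1 / (((n - n / 2 : ℕ) : ℝ) + 1) ^ 2 ≤ 4 / (n : ℝ) ^ 2 := by
    have hn0 : (0 : ℝ) < n := by exact_mod_cast (by omega : 0 < n)
    have hhalf : (n : ℝ) ≤ 2 * (((n - n / 2 : ℕ) : ℝ) + 1) := by
      exact_mod_cast (by omega : n ≤ 2 * (n - n / 2 + 1))
    rw [div_le_div_iff₀ (by positivity) (by positivity)]
    nlinarith [pow_le_pow_left₀ hn0.le hhalf 2]
  have hrest : 0 ≤ 1 / (((n - n / 2 : ℕ) : ℝ) + (n / 2 : ℕ) + 1) ^ 2 := by positivity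
  linarith
end

section
/- Let (X,d) be a separable metric space, T : X → X a Borel measurable map, and μ a T-invariant finite Borel measure on X. Then for every y ∈ X, for μ-almost every x ∈ X the hitting-time indicators are bounded below by the local dimensions at y: R_(x,y) ≥ d_μ(y) and R̄(x,y) ≥ d̄_μ(y). -/
open Filter MeasureTheory Metric Set

/-- If the orbit of `x` avoids `B(y,r)` up to time `r ^ (-c)`, then the hitting quotient
is at least `c`. -/
theorem le_hitQuot_of_forall_notMem {X : Type*} [MetricSpace X] {T : X → X} {x y : X} {r c : ℝ}
    (hr : 0 < r) (hr1 : r < 1)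
    (h : ∀ k : ℕ, 0 < k → (k : ℝ) ≤ r ^ (-c) → T^[k] x ∉ Metric.ball y r) :
    (c : EReal) ≤ hitQuot T x y r := by
  unfold hitQuot
  split_ifs with htop
  · exact le_top
  have hne : {n : ℕ∞ | ∃ k : ℕ, n = k ∧ 0 < k ∧ T^[k] x ∈ Metric.ball y r}.Nonempty := by
    by_contra hempty
    rw [Set.not_nonempty_iff_eq_empty] at hempty
    exact htop (by rw [hitTime, hempty, sInf_empty])
  obtain ⟨k, hk, hk0, hkmem⟩ := csInf_mem hne
  have hk' : hitTime T x y r = k := hk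
  have hlt : r ^ (-c) < k := by
    by_contra! hle
    exact h k hk0 hle hkmem
  have hlog : -c * Real.log r ≤ Real.log k := by
    rw [← Real.log_rpow hr]
    exact Real.log_le_log (Real.rpow_pos_of_pos hr _) hlt.le
  rw [hk', ENat.toNat_natCast, EReal.coe_le_coe_iff, le_div_iff₀ (neg_pos.2 (Real.log_neg hr hr1))]
  linarith

theorem Rlow_nonneg {X : Type*} [MetricSpace X] (T : X → X) (x y : X) : 0 ≤ Rlow T x y := by
  refine le_liminf_of_le (by isBoundedDefault) ?_
  filter_upwards [Ioo_mem_nhdsGT (zero_lt_one (α := ℝ))] with r hr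
  unfold hitQuot
  split_ifs
  · exact le_top
  · exact EReal.coe_nonneg.2 (div_nonneg (Real.log_natCast_nonneg _)
      (neg_nonneg.2 (Real.log_nonpos hr.1.le hr.2.le)))

theorem Rbar_nonneg {X : Type*} [MetricSpace X] (T : X → X) (x y : X) : 0 ≤ Rbar T x y :=
  (Rlow_nonneg T x y).trans (liminf_le_limsup (by isBoundedDefault) (by isBoundedDefault))

theorem measureReal_ball_le_rpow {X : Type*} [MetricSpace X] [MeasurableSpace X] {μ : Measure X}
    {y : X} {r b : ℝ} (hr : 0 < r) (hr1 : r < 1)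
    (h : (b : EReal) <
      ((Real.log (μ (Metric.ball y r)).toReal / Real.log r : ℝ) : EReal)) :
    μ.real (Metric.ball y r) ≤ r ^ b := by
  rw [EReal.coe_lt_coe_iff, lt_div_iff_of_neg (Real.log_neg hr hr1), ← Real.log_rpow hr] at h
  rcases (measureReal_nonneg (μ := μ) (s := Metric.ball y r)).eq_or_lt with h0 | h0
  · rw [← h0]; positivity
  · exact ((Real.log_lt_log_iff h0 (Real.rpow_pos_of_pos hr _)).1 h).le

/-- Borel–Cantelli for hitting balls whose radii decay geometrically. -/
theorem ae_eventually_iterate_notMem_ball {X : Type*} [MetricSpace X]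
    [MeasurableSpace X] [BorelSpace X] {μ : Measure X} [IsFiniteMeasure μ]
    {T : X → X} (hinv : MeasurePreserving T μ μ) {y : X} {a b : ℝ} (hab : a < b)
    {s : ℕ → ℝ} (hs0 : ∀ j, 0 < s j) (hs : ∀ j, s j ≤ (1 / 2) ^ j)
    (hμ : ∀ j, μ.real (Metric.ball y (s j)) ≤ s j ^ b) :
    ∀ᵐ x ∂μ, ∀ᶠ j in atTop, ∀ k : ℕ, 0 < k → (k : ℝ) ≤ s j ^ (-a) →
      T^[k] x ∉ Metric.ball y (s j) := by
  let A : ℕ → Set X := fun j =>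
    ⋃ k ∈ Finset.Icc 1 ⌊s j ^ (-a)⌋₊, T^[k] ⁻¹' Metric.ball y (s j)
  have hA : ∀ j, μ.real (A j) ≤ ((1 / 2 : ℝ) ^ (b - a)) ^ j := by
    intro j
    have hpos : 0 ≤ s j ^ (-a) := (Real.rpow_pos_of_pos (hs0 j) _).le
    calc μ.real (A j)
        ≤ ∑ k ∈ Finset.Icc 1 ⌊s j ^ (-a)⌋₊, μ.real (T^[k] ⁻¹' Metric.ball y (s j)) :=
          measureReal_biUnion_finset_le _ _
      _ = ⌊s j ^ (-a)⌋₊ * μ.real (Metric.ball y (s j)) := by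
          rw [Finset.sum_congr rfl fun k _ => ?_, Finset.sum_const, Nat.card_Icc,
            Nat.add_sub_cancel, nsmul_eq_mul]
          exact (hinv.iterate k).measureReal_preimage measurableSet_ball.nullMeasurableSet
      _ ≤ s j ^ (-a) * s j ^ b :=
          mul_le_mul (Nat.floor_le hpos) (hμ j) measureReal_nonneg hpos
      _ = s j ^ (b - a) := by rw [← Real.rpow_add (hs0 j)]; congr 1; ring
      _ ≤ ((1 / 2 : ℝ) ^ j) ^ (b - a) :=
          Real.rpow_le_rpow (hs0 j).le (hs j) (sub_pos.2 hab).le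
      _ = ((1 / 2 : ℝ) ^ (b - a)) ^ j := by
          rw [← Real.rpow_natCast, ← Real.rpow_natCast, ← Real.rpow_mul (by norm_num),
            ← Real.rpow_mul (by norm_num), mul_comm]
  have hsummable : Summable fun j : ℕ => ((1 / 2 : ℝ) ^ (b - a)) ^ j :=
    summable_geometric_of_lt_one (by positivity)
      (Real.rpow_lt_one (by norm_num) (by norm_num) (sub_pos.2 hab))
  have hsum : ∑' j, μ (A j) ≠ ⊤ := by
    refine ne_top_of_le_ne_top hsummable.tsum_ofReal_ne_top (ENNReal.tsum_le_tsum fun j => ?_)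
    rw [← ofReal_measureReal (measure_ne_top μ _)]
    exact ENNReal.ofReal_le_ofReal (hA j)
  filter_upwards [ae_eventually_notMem hsum] with x hx
  filter_upwards [hx] with j hj k hk0 hk hmem
  exact hj (Set.mem_biUnion (Finset.mem_coe.2 (Finset.mem_Icc.2 ⟨hk0, Nat.le_floor hk⟩)) hmem)

theorem ae_le_Rlow_of_lt_lowerLocalDim {X : Type*} [MetricSpace X]
    [MeasurableSpace X] [BorelSpace X] {μ : Measure X} [IsFiniteMeasure μ]
    {T : X → X} (hinv : MeasurePreserving T μ μ) {y : X} {c : ℝ}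
    (hc : (c : EReal) < lowerLocalDim μ y) : ∀ᵐ x ∂μ, (c : EReal) ≤ Rlow T x y := by
  rcases le_or_gt c 0 with hc0 | hc0
  · exact ae_of_all _ fun x => (EReal.coe_nonpos.2 hc0).trans (Rlow_nonneg T x y)
  obtain ⟨b, hcb, hb⟩ := EReal.lt_iff_exists_real_btwn.1 hc
  rw [EReal.coe_lt_coe_iff] at hcb
  obtain ⟨a, hca, hab⟩ := exists_between hcb
  have hev := eventually_lt_of_lt_liminf hb (by isBoundedDefault)
  obtain ⟨δ, hδ0, hδ⟩ := (mem_nhdsGT_iff_exists_Ioo_subset).1 hev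
  obtain ⟨N, hN⟩ := exists_pow_lt_of_lt_one hδ0 (one_half_lt_one (α := ℝ))
  have hsmall : ∀ n : ℕ, (1 / 2 : ℝ) ^ (n + (N + 1)) ≤ (1 / 2) ^ n := fun n =>
    pow_le_pow_of_le_one (by norm_num) (by norm_num) (by omega)
  have hBC := ae_eventually_iterate_notMem_ball (T := T) (y := y) hinv hab
    (s := fun j => (1 / 2 : ℝ) ^ (j + (N + 1))) (fun j => by positivity) hsmall
    (fun j => by
      refine measureReal_ball_le_rpow (by positivity)
        (pow_lt_one₀ (by norm_num) (by norm_num) (by omega))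
        (hδ ⟨by positivity, lt_of_le_of_lt ?_ hN⟩)
      exact pow_le_pow_of_le_one (by norm_num) (by norm_num) (by omega))
  filter_upwards [hBC] with x hx
  obtain ⟨J, hJ⟩ := eventually_atTop.1 hx
  refine le_liminf_of_le (by isBoundedDefault) ?_
  have hlog : ∀ᶠ r in nhdsWithin (0 : ℝ) (Set.Ioi 0), Real.log r ≤ -(a * Real.log 2 / (a - c)) :=
    Real.tendsto_log_nhdsGT_zero.eventually_le_atBot _
  filter_upwards [hlog, Ioo_mem_nhdsGT (show (0 : ℝ) < (1 / 2) ^ (J + (N + 1)) by positivity)]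
    with r hrlog hr
  have hr1 : r < 1 := hr.2.trans (pow_lt_one₀ (by norm_num) (by norm_num) (by omega))
  obtain ⟨n, hn1, hn2⟩ := exists_nat_pow_near_of_lt_one hr.1 hr1.le
    (show (0 : ℝ) < 1 / 2 by norm_num) (by norm_num)
  have hJn : J + (N + 1) < n + 1 :=
    (pow_lt_pow_iff_right_of_lt_one₀ (by norm_num) (by norm_num)).1 (hn1.trans hr.2)
  obtain ⟨j, hj, rfl⟩ : ∃ j, J ≤ j ∧ n = j + (N + 1) := ⟨n - (N + 1), by omega, by omega⟩
  refine le_hitQuot_of_forall_notMem hr.1 hr1 fun k hk0 hk hmem =>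
    hJ j hj k hk0 (hk.trans ?_) (Metric.ball_subset_ball hn2 hmem)
  have hs : (1 / 2 : ℝ) ^ (j + (N + 1)) ≤ 2 * r := by
    rw [pow_succ] at hn1
    linarith
  calc r ^ (-c) ≤ (2 * r) ^ (-a) := by
        have h2r : 0 < 2 * r := by linarith [hr.1]
        rw [← Real.log_le_log_iff (Real.rpow_pos_of_pos hr.1 _) (Real.rpow_pos_of_pos h2r _),
          Real.log_rpow hr.1, Real.log_rpow h2r, Real.log_mul two_ne_zero hr.1.ne']
        rw [le_neg, div_le_iff₀ (sub_pos.2 hca)] at hrlog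
        linarith
    _ ≤ ((1 / 2 : ℝ) ^ (j + (N + 1))) ^ (-a) :=
        Real.rpow_le_rpow_of_nonpos (by positivity) hs (by linarith)

theorem ae_le_Rbar_of_lt_upperLocalDim {X : Type*} [MetricSpace X]
    [MeasurableSpace X] [BorelSpace X] {μ : Measure X} [IsFiniteMeasure μ]
    {T : X → X} (hinv : MeasurePreserving T μ μ) {y : X} {c : ℝ}
    (hc : (c : EReal) < upperLocalDim μ y) : ∀ᵐ x ∂μ, (c : EReal) ≤ Rbar T x y := by
  rcases le_or_gt c 0 with hc0 | hc0
  · exact ae_of_all _ fun x => (EReal.coe_nonpos.2 hc0).trans (Rbar_nonneg T x y)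
  obtain ⟨b, hcb, hb⟩ := EReal.lt_iff_exists_real_btwn.1 hc
  rw [EReal.coe_lt_coe_iff] at hcb
  have hfreq := frequently_lt_of_lt_limsup (by isBoundedDefault) hb
  have hex : ∀ j : ℕ, ∃ r : ℝ, r ∈ Set.Ioo (0 : ℝ) ((1 / 2) ^ j) ∧
      (b : EReal) < ((Real.log (μ (Metric.ball y r)).toReal / Real.log r : ℝ) : EReal) :=
    fun j => ((hfreq.and_eventually (Ioo_mem_nhdsGT (by positivity))).mono
      fun r hr => hr.symm).exists
  choose s hs hsb using hex
  have hs1 : ∀ j, s j < 1 := fun j =>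
    (hs j).2.trans_le (pow_le_one₀ (by norm_num) (by norm_num))
  have htends : Tendsto s atTop (nhdsWithin 0 (Set.Ioi 0)) := by
    refine tendsto_nhdsWithin_iff.2 ⟨?_, .of_forall fun j => (hs j).1⟩
    exact squeeze_zero (fun j => (hs j).1.le) (fun j => (hs j).2.le)
      (tendsto_pow_atTop_nhds_zero_of_lt_one (by norm_num) (by norm_num))
  filter_upwards [ae_eventually_iterate_notMem_ball (T := T) (y := y) hinv hcb
    (fun j => (hs j).1) (fun j => (hs j).2.le) fun j =>
      measureReal_ball_le_rpow (hs j).1 (hs1 j) (hsb j)] with x hx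
  refine le_limsup_of_frequently_le (htends.frequently (Eventually.frequently ?_))
    (by isBoundedDefault)
  filter_upwards [hx] with j hj
  exact le_hitQuot_of_forall_notMem (hs j).1 (hs1 j) hj

/-- An almost everywhere lower bound may be checked on real constants. -/
theorem ae_le_of_forall_real_lt {X : Type*} [MeasurableSpace X] {μ : Measure X} {d : EReal}
    {f : X → EReal} (h : ∀ c : ℝ, (c : EReal) < d → ∀ᵐ x ∂μ, (c : EReal) ≤ f x) :
    ∀ᵐ x ∂μ, d ≤ f x := by
  have hrat : ∀ᵐ x ∂μ, ∀ q : ℚ, ((q : ℝ) : EReal) < d → ((q : ℝ) : EReal) ≤ f x :=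
    ae_all_iff.2 fun q => by
      by_cases hq : ((q : ℝ) : EReal) < d
      · filter_upwards [h q hq] with x hx _ using hx
      · exact ae_of_all _ fun x hx => absurd hx hq
  filter_upwards [hrat] with x hx
  by_contra! hlt
  obtain ⟨q, hq1, hq2⟩ := EReal.lt_iff_exists_rat_btwn.1 hlt
  exact (hx q hq2).not_gt hq1

/-- in a separable metric space with an invariant finite Borel measure,
    the hitting-time indicators are a.e. bounded below by the local dimensions at `y`. -/
theorem dim_le_hitting {X : Type*} [MetricSpace X] [TopologicalSpace.SeparableSpace X]
    [MeasurableSpace X] [BorelSpace X] (μ : MeasureTheory.Measure X) [IsFiniteMeasure μ]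
    (T : X → X) (hT : Measurable T) (hinv : MeasureTheory.MeasurePreserving T μ μ) (y : X) :
    ∀ᵐ x ∂μ, lowerLocalDim μ y ≤ Rlow T x y ∧ upperLocalDim μ y ≤ Rbar T x y := by
  exact (ae_le_of_forall_real_lt fun _ hc => ae_le_Rlow_of_lt_lowerLocalDim hinv hc).and
    (ae_le_of_forall_real_lt fun _ hc => ae_le_Rbar_of_lt_upperLocalDim hinv hc)
end

section
/- Let (X,d) be a metric space, T : X → X a map, and y, x₀ ∈ X. If liminf_{n→∞} n·d(T^n(y),x₀) < ∞, then the lower hitting-time indicator satisfies R_(y,x₀) ≤ 1. -/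
open Filter MeasureTheory Metric Set

open scoped ENNReal

/-- A visit of the orbit to the ball at a positive time `n` bounds the hitting-time quotient. -/
theorem hitQuot_le_of_iterate_mem_ball {X : Type*} [MetricSpace X] {T : X → X} {x y : X}
    {r : ℝ} {n : ℕ} (hr0 : 0 < r) (hr1 : r < 1) (hn : 0 < n)
    (hmem : T^[n] x ∈ Metric.ball y r) :
    hitQuot T x y r ≤ ((Real.log n / (-Real.log r) : ℝ) : EReal) := by
  have hle : hitTime T x y r ≤ n := sInf_le ⟨n, rfl, hn, hmem⟩
  have hne : hitTime T x y r ≠ ⊤ := ne_top_of_le_ne_top (ENat.natCast_ne_top n) hle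
  have hnat : (hitTime T x y r).toNat ≤ n := ENat.toNat_le_of_le_natCast hle
  have hlog : 0 < -Real.log r := neg_pos.2 (Real.log_neg hr0 hr1)
  rw [hitQuot, if_neg hne, EReal.coe_le_coe_iff]
  refine div_le_div_of_nonneg_right ?_ hlog.le
  rcases Nat.eq_zero_or_pos (hitTime T x y r).toNat with h0 | hpos
  · simpa [h0] using Real.log_natCast_nonneg n
  · exact Real.log_le_log (by exact_mod_cast hpos) (by exact_mod_cast hnat)

theorem tendsto_log_natCast_div_neg_log_div {C : ℝ} (hC : 0 < C) :
    Tendsto (fun n : ℕ => Real.log n / (-Real.log (C / n))) atTop (nhds 1) := by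
  have hlog : Tendsto (fun n : ℕ => Real.log n) atTop atTop :=
    Real.tendsto_log_atTop.comp tendsto_natCast_atTop_atTop
  have hlim : Tendsto (fun n : ℕ => (1 - Real.log C / Real.log n)⁻¹) atTop (nhds 1) := by
    simpa using ((hlog.const_div_atTop (Real.log C)).const_sub 1).inv₀ (by simp)
  refine hlim.congr' ?_
  filter_upwards [eventually_gt_atTop 0, hlog.eventually_gt_atTop 0] with n hn hn'
  have hnR : (n : ℝ) ≠ 0 := by exact_mod_cast hn.ne'
  rw [Real.log_div hC.ne' hnR, neg_sub, one_sub_div hn'.ne', inv_div]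

/-- if `liminf n · d(T^n y, x₀) < ∞` then `R_(y,x₀) ≤ 1`. -/
theorem Rlow_le_one_of_liminf_lt_top {X : Type*} [MetricSpace X] (T : X → X) (y x₀ : X)
    (h : Filter.liminf (fun n : ℕ => (n : ℝ≥0∞) * edist (T^[n] y) x₀) Filter.atTop < ⊤) :
    Rlow T y x₀ ≤ (1 : EReal) := by
  obtain ⟨a, ha, ha_top⟩ := exists_between h
  obtain ⟨C, rfl⟩ : ∃ C : NNReal, (C : ℝ≥0∞) = a := ⟨a.toNNReal, ENNReal.coe_toNNReal ha_top.ne⟩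
  have hC : (0 : ℝ) < C := by
    exact_mod_cast ENNReal.coe_pos.1 (pos_of_gt ha)
  have hfreq := frequently_lt_of_liminf_lt (by isBoundedDefault) ha
  have hr : Tendsto (fun n : ℕ => (C : ℝ) / n) atTop (nhdsWithin 0 (Set.Ioi 0)) := by
    refine tendsto_nhdsWithin_iff.2 ⟨tendsto_const_div_atTop_nhds_zero_nat _, ?_⟩
    filter_upwards [eventually_gt_atTop 0] with n hn
    have : (0 : ℝ) < n := by exact_mod_cast hn
    exact div_pos hC this
  have hlt_one : ∀ᶠ n : ℕ in atTop, (C : ℝ) / n < 1 :=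
    (tendsto_const_div_atTop_nhds_zero_nat _).eventually_lt_const one_pos
  refine EReal.le_of_forall_lt_iff_le.1 fun c hc => ?_
  have hquot := (tendsto_log_natCast_div_neg_log_div hC).eventually_lt_const
    (show (1 : ℝ) < c by exact_mod_cast hc)
  refine liminf_le_of_frequently_le' (hr.frequently ?_)
  refine (hfreq.and_eventually (hlt_one.and (hquot.and (eventually_gt_atTop 0)))).mono ?_
  rintro n ⟨hn, hn1, hnc, hn0⟩
  have hnR : (0 : ℝ) < n := by exact_mod_cast hn0
  have hmem : T^[n] y ∈ Metric.ball x₀ (C / n) := by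
    rw [edist_nndist] at hn
    have hn' : (n : ℝ) * dist (T^[n] y) x₀ < C := by exact_mod_cast hn
    rwa [Metric.mem_ball, lt_div_iff₀' hnR]
  exact (hitQuot_le_of_iterate_mem_ball (div_pos hC hnR) hn1 hn0 hmem).trans
    (EReal.coe_le_coe_iff.2 hnc.le)
end

section
/- Let (X,d) be a compact metric space, T : X → X a Borel measurable map, and μ a T-invariant Borel probability measure. Let x₀ ∈ X be a point with μ({x₀}) = 0 at which the local dimension of μ exists: d_μ(x₀) = d̄_μ(x₀) = d with 0 < d < ∞. Let α > 1 and let f : X∖{x₀} → [0,∞) be continuous with lim_{x→x₀} f(x)·d(x,x₀)^α ∈ (0,∞). Then for μ-almost every x ∈ X the Birkhoff sums S_n(x) = Σ_{i=0}^{n} f(T^i(x)) satisfy limsup_{n→∞} log(S_n(x))/log(n) ≤ α/d + 1. -/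
open Filter MeasureTheory Metric Set

/-- A sequence bounded by a multiple of `i ^ s` for all large `i` is bounded by a multiple of
`(i + 1) ^ s` for every `i`. -/
theorem exists_forall_le_mul_add_one_rpow {a : ℕ → ℝ} {C s : ℝ} (hC : 0 ≤ C) (hs : 0 ≤ s)
    (h : ∀ᶠ i : ℕ in atTop, a i ≤ C * (i : ℝ) ^ s) :
    ∃ K : ℝ, 1 ≤ K ∧ ∀ i, a i ≤ K * ((i : ℝ) + 1) ^ s := by
  obtain ⟨N, hN⟩ := eventually_atTop.1 h
  have hsum : 0 ≤ ∑ j ∈ Finset.range N, |a j| := Finset.sum_nonneg fun j _ => abs_nonneg _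
  refine ⟨1 + C + ∑ j ∈ Finset.range N, |a j|, by linarith, fun i => ?_⟩
  have h1 : (1 : ℝ) ≤ ((i : ℝ) + 1) ^ s :=
    Real.one_le_rpow (by linarith [Nat.cast_nonneg (α := ℝ) i]) hs
  rcases lt_or_ge i N with hi | hi
  · have h2 : |a i| ≤ ∑ j ∈ Finset.range N, |a j| :=
      Finset.single_le_sum (f := fun j => |a j|) (fun j _ => abs_nonneg _) (Finset.mem_range.2 hi)
    have h3 := le_abs_self (a i)
    nlinarith
  · have h2 : (i : ℝ) ^ s ≤ ((i : ℝ) + 1) ^ s :=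
      Real.rpow_le_rpow (Nat.cast_nonneg i) (by linarith) hs
    have h3 := hN i hi
    nlinarith

/-- Polynomial growth of the terms of order `s` bounds the growth exponent of the partial sums
by `s + 1`. -/
theorem limsup_log_sum_div_log_le {a : ℕ → ℝ} {C s : ℝ} (hC : 0 ≤ C) (hs : 0 ≤ s)
    (ha : ∀ i, 0 ≤ a i) (h : ∀ᶠ i : ℕ in atTop, a i ≤ C * (i : ℝ) ^ s) :
    limsup (fun n : ℕ =>
      ((Real.log (∑ i ∈ Finset.range (n + 1), a i) / Real.log (n : ℝ) : ℝ) : EReal)) atTop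
      ≤ ((s + 1 : ℝ) : EReal) := by
  obtain ⟨K, hK, hle⟩ := exists_forall_le_mul_add_one_rpow hC hs h
  have hsum (n : ℕ) : ∑ i ∈ Finset.range (n + 1), a i ≤ K * ((n : ℝ) + 1) ^ (s + 1) := by
    have : ∀ i ∈ Finset.range (n + 1), a i ≤ K * ((n : ℝ) + 1) ^ s := fun i hi => by
      have hin : (i : ℝ) ≤ n := by exact_mod_cast Nat.lt_succ_iff.1 (Finset.mem_range.1 hi)
      refine (hle i).trans (mul_le_mul_of_nonneg_left ?_ (by linarith))
      exact Real.rpow_le_rpow (by positivity) (by linarith) hs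
    refine (Finset.sum_le_card_nsmul _ _ _ this).trans (le_of_eq ?_)
    rw [Finset.card_range, nsmul_eq_mul, Real.rpow_add_one (by positivity)]
    push_cast
    ring
  set M : ℝ := Real.log (K * 2 ^ (s + 1))
  have hbound : ∀ᶠ n : ℕ in atTop,
      ((Real.log (∑ i ∈ Finset.range (n + 1), a i) / Real.log (n : ℝ) : ℝ) : EReal)
        ≤ ((M / Real.log n + (s + 1) : ℝ) : EReal) := by
    filter_upwards [eventually_ge_atTop 2] with n hn
    have hn' : (2 : ℝ) ≤ n := by exact_mod_cast hn
    have hlog : 0 < Real.log n := Real.log_pos (by linarith)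
    have h2 : (1 : ℝ) ≤ 2 ^ (s + 1) := Real.one_le_rpow (by norm_num) (by linarith)
    have hK2 : 1 ≤ K * 2 ^ (s + 1) := by nlinarith
    have hM : 0 ≤ M := Real.log_nonneg hK2
    rw [EReal.coe_le_coe_iff, div_add' _ _ _ hlog.ne']
    gcongr
    rcases (Finset.sum_nonneg fun i (_ : i ∈ Finset.range (n + 1)) => ha i).eq_or_lt with h0 | h0
    · rw [← h0, Real.log_zero]
      positivity
    · calc Real.log (∑ i ∈ Finset.range (n + 1), a i)
          ≤ Real.log (K * 2 ^ (s + 1) * (n : ℝ) ^ (s + 1)) := by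
            refine Real.log_le_log h0 ((hsum n).trans ?_)
            rw [mul_assoc, ← Real.mul_rpow (by norm_num) (by linarith)]
            gcongr
            linarith
        _ = M + (s + 1) * Real.log n := by
            rw [Real.log_mul (by positivity) (by positivity), Real.log_rpow (by linarith)]
  refine (limsup_le_limsup hbound).trans (Tendsto.limsup_eq ?_).le
  refine (continuous_coe_real_ereal.tendsto _).comp ?_
  have : Tendsto (fun n : ℕ => M / Real.log (n : ℝ)) atTop (nhds 0) :=
    tendsto_const_nhds.div_atTop (Real.tendsto_log_atTop.comp tendsto_natCast_atTop_atTop)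
  simpa using this.add_const (s + 1)

/-- Below the lower local dimension, small balls have at most power-law measure. -/
theorem eventually_measure_ball_le_rpow {X : Type*} [MetricSpace X] [MeasurableSpace X]
    {μ : Measure X} [IsFiniteMeasure μ] {x₀ : X} {d : ℝ}
    (h : (d : EReal) < lowerLocalDim μ x₀) :
    ∀ᶠ r : ℝ in nhdsWithin 0 (Ioi 0), μ (ball x₀ r) ≤ ENNReal.ofReal (r ^ d) := by
  filter_upwards [eventually_lt_of_lt_liminf h, Ioo_mem_nhdsGT (zero_lt_one' ℝ)] with r hr hr1
  rcases eq_or_ne (μ (ball x₀ r)) 0 with h0 | h0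
  · simp [h0]
  rw [EReal.coe_lt_coe_iff, lt_div_iff_of_neg (Real.log_neg hr1.1 hr1.2)] at hr
  have hpos : 0 < (μ (ball x₀ r)).toReal := ENNReal.toReal_pos h0 (measure_ne_top _ _)
  rw [← ENNReal.ofReal_toReal (measure_ne_top μ (ball x₀ r))]
  refine ENNReal.ofReal_le_ofReal ?_
  rw [← Real.log_le_log_iff hpos (Real.rpow_pos_of_pos hr1.1 _), Real.log_rpow hr1.1]
  exact hr.le

/-- Almost every orbit eventually stays out of the shrinking balls `B(x₀, n ^ (-p))`
when `p` times the lower local dimension exceeds one. -/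
theorem ae_eventually_rpow_neg_le_dist_iterate {X : Type*} [MetricSpace X] [MeasurableSpace X]
    [BorelSpace X] {μ : Measure X} [IsFiniteMeasure μ] {T : X → X}
    (hT : MeasurePreserving T μ μ) {x₀ : X} {p : ℝ} (hp : 0 < p)
    (h : ((1 / p : ℝ) : EReal) < lowerLocalDim μ x₀) :
    ∀ᵐ x ∂μ, ∀ᶠ n : ℕ in atTop, (n : ℝ) ^ (-p) ≤ dist (T^[n] x) x₀ := by
  obtain ⟨d, hpd, hd⟩ := EReal.lt_iff_exists_real_btwn.1 h
  rw [EReal.coe_lt_coe_iff, div_lt_iff₀ hp] at hpd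
  have htend : Tendsto (fun n : ℕ => (n : ℝ) ^ (-p)) atTop (nhdsWithin 0 (Ioi 0)) := by
    refine tendsto_nhdsWithin_iff.2
      ⟨(tendsto_rpow_neg_atTop hp).comp tendsto_natCast_atTop_atTop, ?_⟩
    filter_upwards [eventually_gt_atTop 0] with n hn
    exact Real.rpow_pos_of_pos (by exact_mod_cast hn) _
  obtain ⟨N, hN⟩ := eventually_atTop.1 (htend.eventually (eventually_measure_ball_le_rpow hd))
  have hsummable : Summable fun n : ℕ => ((n : ℝ) ^ (-p)) ^ d := by
    have : (fun n : ℕ => ((n : ℝ) ^ (-p)) ^ d) = fun n : ℕ => (n : ℝ) ^ (-(d * p)) := by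
      funext n
      rw [← Real.rpow_mul (Nat.cast_nonneg n)]
      ring_nf
    rw [this, Real.summable_nat_rpow]
    linarith
  have hfin : ∑' n, μ (T^[n + N] ⁻¹' ball x₀ (((n + N : ℕ) : ℝ) ^ (-p))) ≠ ⊤ := by
    refine ne_top_of_le_ne_top ((summable_nat_add_iff N).2 hsummable).tsum_ofReal_ne_top
      (ENNReal.tsum_le_tsum fun n => ?_)
    rw [(hT.iterate (n + N)).measure_preimage measurableSet_ball.nullMeasurableSet]
    exact hN _ (Nat.le_add_left N n)
  filter_upwards [ae_eventually_notMem hfin] with x hx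
  obtain ⟨m, hm⟩ := eventually_atTop.1 hx
  filter_upwards [eventually_ge_atTop (m + N)] with n hn
  have := hm (n - N) (by omega)
  rw [Nat.sub_add_cancel (by omega)] at this
  simpa using this

/-- On a compact space, a function with a pole of order `α` at `x₀` is globally dominated
by a multiple of `dist z x₀ ^ (-α)`. -/
theorem exists_forall_mul_dist_rpow_le {X : Type*} [MetricSpace X] [CompactSpace X] {x₀ : X}
    {α L : ℝ} (hα : 0 ≤ α) {f : X → ℝ} (hfc : ContinuousOn f {x₀}ᶜ)
    (hlim : Tendsto (fun z => f z * dist z x₀ ^ α) (nhdsWithin x₀ {x₀}ᶜ) (nhds L)) :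
    ∃ C : ℝ, 0 ≤ C ∧ ∀ z, z ≠ x₀ → f z * dist z x₀ ^ α ≤ C := by
  have hcont : ContinuousOn (fun z => f z * dist z x₀ ^ α) {x₀}ᶜ :=
    hfc.mul ((continuous_id.dist continuous_const).rpow_const fun _ => Or.inr hα).continuousOn
  obtain ⟨ε, hε, hball⟩ :=
    Metric.mem_nhdsWithin_iff.1 (hlim.eventually (eventually_le_nhds (lt_add_one L)))
  obtain ⟨C, hC⟩ := (isOpen_ball.isClosed_compl.isCompact (s := (ball x₀ ε)ᶜ)).bddAbove_image
    (hcont.mono (compl_subset_compl.2 (singleton_subset_iff.2 (mem_ball_self hε))))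
  refine ⟨max 0 (max (L + 1) C), le_max_left _ _, fun z hz => ?_⟩
  by_cases hzb : z ∈ ball x₀ ε
  · exact (hball ⟨hzb, hz⟩).trans ((le_max_left _ _).trans (le_max_right _ _))
  · exact (hC (mem_image_of_mem _ hzb)).trans ((le_max_right _ _).trans (le_max_right _ _))

/-- in a general system, the growth rate of Birkhoff sums of an observable
    with an asymptote of order `α` at a point `x₀` of exact local dimension `d` is a.e.
    bounded by `α/d + 1`. -/
theorem birkhoff_growth_le_of_dim {X : Type*} [MetricSpace X] [CompactSpace X]
    [MeasurableSpace X] [BorelSpace X] (μ : MeasureTheory.Measure X)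
    [IsProbabilityMeasure μ] (T : X → X) (hT : Measurable T)
    (hinv : MeasureTheory.MeasurePreserving T μ μ)
    (x₀ : X) (hx₀ : μ {x₀} = 0) (d : ℝ) (hd : 0 < d)
    (hdim_u : upperLocalDim μ x₀ = (d : EReal)) (hdim_l : lowerLocalDim μ x₀ = (d : EReal))
    (α : ℝ) (hα : 1 < α)
    (f : X → ℝ) (hf0 : ∀ z, z ≠ x₀ → 0 ≤ f z) (hfc : ContinuousOn f {x₀}ᶜ)
    (L : ℝ) (hL : 0 < L)
    (hlim : Filter.Tendsto (fun z => f z * dist z x₀ ^ α) (nhdsWithin x₀ {x₀}ᶜ) (nhds L)) :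
    ∀ᵐ x ∂μ,
      Filter.limsup (fun n : ℕ =>
          ((Real.log (∑ i ∈ Finset.range (n + 1), f (T^[i] x)) / Real.log (n : ℝ) : ℝ) : EReal))
          Filter.atTop ≤ ((α / d + 1 : ℝ) : EReal) := by
  have hα0 : 0 < α := by linarith
  obtain ⟨C, hC, hfC⟩ := exists_forall_mul_dist_rpow_le hα0.le hfc hlim
  have horbit : ∀ᵐ x ∂μ, ∀ n : ℕ, T^[n] x ≠ x₀ := by
    refine ae_all_iff.2 fun n => ?_
    exact (hinv.iterate n).quasiMeasurePreserving.ae (p := fun y => y ≠ x₀)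
      (measure_eq_zero_iff_ae_notMem.1 hx₀)
  have hdist : ∀ᵐ x ∂μ, ∀ k : ℕ, ∀ᶠ n : ℕ in atTop,
      (n : ℝ) ^ (-(1 / d + 1 / ((k : ℝ) + 1))) ≤ dist (T^[n] x) x₀ := by
    refine ae_all_iff.2 fun k => ae_eventually_rpow_neg_le_dist_iterate hinv (by positivity) ?_
    rw [hdim_l, EReal.coe_lt_coe_iff, div_lt_iff₀ (by positivity), mul_add,
      mul_one_div_cancel hd.ne']
    exact lt_add_of_pos_right _ (by positivity)
  filter_upwards [horbit, hdist] with x hx hxd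
  have hk (k : ℕ) := limsup_log_sum_div_log_le (a := fun i => f (T^[i] x)) hC
    (s := (1 / d + 1 / ((k : ℝ) + 1)) * α) (by positivity) (fun i => hf0 _ (hx i)) (by
      filter_upwards [hxd k, eventually_gt_atTop 0] with n hn hn0
      have hn0' : (0 : ℝ) < n := by exact_mod_cast hn0
      have hpow : ((n : ℝ) ^ ((1 / d + 1 / ((k : ℝ) + 1)) * α))⁻¹ ≤ dist (T^[n] x) x₀ ^ α := by
        rw [← Real.rpow_neg hn0'.le, ← neg_mul, Real.rpow_mul hn0'.le]
        exact Real.rpow_le_rpow (by positivity) hn hα0.le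
      rw [← div_le_iff₀ (by positivity), div_eq_mul_inv]
      exact (mul_le_mul_of_nonneg_left hpow (hf0 _ (hx n))).trans (hfC _ (hx n)))
  refine ge_of_tendsto' (x := atTop) ((continuous_coe_real_ereal.tendsto _).comp ?_) hk
  have := ((tendsto_one_div_add_atTop_nhds_zero_nat (𝕜 := ℝ)).const_add (1 / d)).mul_const α
  convert this.add_const 1 using 2
  ring
end

section
/- Let T be an interval exchange transformation of [0,1) with discontinuity set D, and assume T is ergodic with respect to Lebesgue measure λ. Suppose there exist C > 0 and a strictly increasing sequence of positive integers (n_k) such that for every k, any two distinct points of the finite set ⋃_{i=0}^{n_k} T^{−i}(D) are at distance at least C/n_k. Then for every discontinuity point x₀ ∈ D, for λ-almost every y ∈ [0,1) the lower hitting-time indicator satisfies R_(y,x₀) = 1. -/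
open Filter MeasureTheory Metric Set

/-- An interval exchange transformation of `[0,1)` with discontinuity set `D`,
    realized as a map `ℝ → ℝ` which is the identity outside `[0,1)`:
    there are `0 = β₀ < β₁ < … < β_m = 1` and constants `c_j` such that
    `T x = x + c_j` on `[β_{j-1}, β_j)`, `T` maps `[0,1)` bijectively onto itself,
    and `D = {β₁, …, β_{m-1}}`. -/
def IsIET (T : ℝ → ℝ) (D : Set ℝ) : Prop :=
  Set.BijOn T (Set.Ico 0 1) (Set.Ico 0 1) ∧
  (∀ x : ℝ, x ∉ Set.Ico (0 : ℝ) 1 → T x = x) ∧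
  ∃ (m : ℕ) (β : ℕ → ℝ) (c : ℕ → ℝ),
    1 ≤ m ∧ β 0 = 0 ∧ β m = 1 ∧ (∀ j, j < m → β j < β (j + 1)) ∧
    D = {x : ℝ | ∃ j, 1 ≤ j ∧ j < m ∧ x = β j} ∧
    ∀ j, j < m → ∀ x ∈ Set.Ico (β j) (β (j + 1)), T x = x + c (j + 1)

lemma hitQuot_le {X : Type*} [MetricSpace X] {T : X → X} {x y : X} {r : ℝ} {k K : ℕ}
    (hr0 : 0 < r) (hr1 : r < 1) (hk : 0 < k) (hkK : k ≤ K) (h : T^[k] x ∈ ball y r) :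
    hitQuot T x y r ≤ ((Real.log K / (-Real.log r) : ℝ) : EReal) := by
  have hle : hitTime T x y r ≤ k := sInf_le ⟨k, rfl, hk, h⟩
  have hne : hitTime T x y r ≠ ⊤ := ne_top_of_le_ne_top (ENat.natCast_ne_top k) hle
  have hlog : Real.log r < 0 := Real.log_neg hr0 hr1
  have hnat : (hitTime T x y r).toNat ≤ K :=
    (ENat.toNat_le_of_le_natCast hle).trans hkK
  rw [hitQuot, if_neg hne, EReal.coe_le_coe_iff]
  refine div_le_div_of_nonneg_right ?_ (by linarith)
  rcases Nat.eq_zero_or_pos (hitTime T x y r).toNat with h0 | h0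
  · rw [h0]; simpa using Real.log_natCast_nonneg K
  · exact Real.log_le_log (by exact_mod_cast h0) (by exact_mod_cast hnat)

lemma le_hitQuot {X : Type*} [MetricSpace X] {T : X → X} {x y : X} {r a : ℝ}
    (h : ∀ k : ℕ, 0 < k → T^[k] x ∈ ball y r → a ≤ Real.log k / (-Real.log r)) :
    (a : EReal) ≤ hitQuot T x y r := by
  rw [hitQuot]
  split_ifs with htop
  · exact le_top
  · have hne : {n : ℕ∞ | ∃ k : ℕ, n = k ∧ 0 < k ∧ T^[k] x ∈ ball y r}.Nonempty := by
      by_contra hempty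
      rw [Set.not_nonempty_iff_eq_empty] at hempty
      exact htop (by rw [hitTime, hempty, sInf_empty])
    obtain ⟨k, hk, hk0, hkb⟩ := csInf_mem hne
    have hk' : hitTime T x y r = k := hk
    rw [EReal.coe_le_coe_iff, hk', ENat.toNat_natCast]
    exact h k hk0 hkb

/-- If the orbit of `x` avoids `y` and approaches it no faster than `n ^ (-b)`, then the lower
hitting-time indicator is at least `1 / b`. -/
lemma one_div_le_Rlow {X : Type*} [MetricSpace X] {T : X → X} {x y : X} {b : ℝ} (hb : 0 < b)
    (hne : ∀ n : ℕ, 0 < n → T^[n] x ≠ y)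
    (hfar : ∀ᶠ n : ℕ in atTop, (n : ℝ) ^ (-b) ≤ dist (T^[n] x) y) :
    ((1 / b : ℝ) : EReal) ≤ Rlow T x y := by
  obtain ⟨N, hN⟩ := eventually_atTop.1 hfar
  have hclose : ∀ᶠ r : ℝ in nhdsWithin 0 (Ioi 0),
      ∀ n ∈ Finset.Icc 1 N, r < dist (T^[n] x) y := by
    rw [Filter.eventually_all_finset]
    intro n hn
    have hpos : 0 < dist (T^[n] x) y := dist_pos.2 (hne n (Finset.mem_Icc.1 hn).1)
    exact (eventually_lt_nhds hpos).filter_mono nhdsWithin_le_nhds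
  have hsmall : ∀ᶠ r : ℝ in nhdsWithin 0 (Ioi 0), r < 1 :=
    (eventually_lt_nhds one_pos).filter_mono nhdsWithin_le_nhds
  refine le_liminf_of_le (by isBoundedDefault) ?_
  filter_upwards [hclose, hsmall, self_mem_nhdsWithin] with r hr hr1 hr0
  have hr0 : 0 < r := hr0
  refine le_hitQuot fun k hk hball => ?_
  rw [mem_ball] at hball
  have hkN : N ≤ k := by
    by_contra hlt
    exact (hr k (Finset.mem_Icc.2 ⟨hk, by omega⟩)).not_ge hball.le
  have hk' : (0 : ℝ) < k := by exact_mod_cast hk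
  have hlt : (k : ℝ) ^ (-b) < r := (hN k hkN).trans_lt hball
  have hlog := Real.log_lt_log (Real.rpow_pos_of_pos hk' _) hlt
  rw [Real.log_rpow hk'] at hlog
  have hlogr := Real.log_neg hr0 hr1
  rw [div_le_div_iff₀ hb (by linarith)]
  linarith

/-- If the orbit of `x` hits the ball of radius `C / n k` about `y` before time `n k + N` for
infinitely many `k`, then the lower hitting-time indicator is at most `1`. -/
lemma Rlow_le_one {X : Type*} [MetricSpace X] {T : X → X} {x y : X} {C : ℝ} (hC : 0 < C)
    {n : ℕ → ℕ} (hn : Tendsto n atTop atTop) (N : ℕ)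
    (hit : ∃ᶠ k in atTop, ∃ j, 0 < j ∧ j ≤ n k + N ∧ T^[j] x ∈ ball y (C / n k)) :
    Rlow T x y ≤ 1 := by
  refine EReal.le_of_forall_lt_iff_le.1 fun a ha => ?_
  have ha : 1 < a := by exact_mod_cast ha
  have hnR : Tendsto (fun k => (n k : ℝ)) atTop atTop := tendsto_natCast_atTop_atTop.comp hn
  have hr : Tendsto (fun k => C / (n k : ℝ)) atTop (nhdsWithin 0 (Ioi 0)) := by
    refine tendsto_nhdsWithin_iff.2 ⟨hnR.const_div_atTop C, ?_⟩
    filter_upwards [hnR.eventually_gt_atTop 0] with k hk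
    exact div_pos hC hk
  refine liminf_le_of_frequently_le' (hr.frequently ?_)
  have hlog : Tendsto (fun k => (a - 1) * Real.log (n k)) atTop atTop :=
    (Real.tendsto_log_atTop.comp hnR).const_mul_atTop (by linarith)
  refine (hit.and_eventually ((hnR.eventually_gt_atTop C).and
    ((hnR.eventually_gt_atTop 0).and ((hn.eventually_ge_atTop N).and
      (hlog.eventually_ge_atTop (Real.log 2 + a * Real.log C)))))).mono ?_
  rintro k ⟨⟨j, hj0, hjn, hj⟩, hkC, hk0, hkN, hklog⟩
  have hr0 : 0 < C / (n k : ℝ) := div_pos hC hk0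
  have hr1 : C / (n k : ℝ) < 1 := (div_lt_one hk0).2 hkC
  refine (hitQuot_le hr0 hr1 hj0 (hjn.trans (show n k + N ≤ 2 * n k by omega)) hj).trans ?_
  have hneg := Real.log_neg hr0 hr1
  rw [EReal.coe_le_coe_iff, div_le_iff₀ (by linarith), Real.log_div hC.ne' hk0.ne']
  push_cast
  rw [Real.log_mul two_ne_zero hk0.ne']
  linarith

namespace IsIET

variable {T : ℝ → ℝ} {D : Set ℝ}

lemma subset_Ico (h : IsIET T D) : D ⊆ Ico 0 1 := by
  obtain ⟨-, -, m, β, c, -, h0, h1, hlt, rfl, -⟩ := h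
  have hmono : ∀ i j, i ≤ j → j ≤ m → β i ≤ β j := by
    intro i j hij
    induction j, hij using Nat.le_induction with
    | base => intro _; exact le_rfl
    | succ j _ ih => intro hj; exact (ih (by omega)).trans (hlt j (by omega)).le
  rintro _ ⟨j, -, hj, rfl⟩
  refine ⟨h0 ▸ hmono 0 j (by omega) hj.le, (hlt j hj).trans_le ?_⟩
  exact h1 ▸ hmono (j + 1) m (by omega) le_rfl

lemma exists_translation (h : IsIET T D) {z : ℝ} (hz : z ∈ Ico (0 : ℝ) 1) :
    ∃ w, z < w ∧ (w = 1 ∨ w ∈ D) ∧ ∀ y ∈ Ico z w, T y = y + (T z - z) := by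
  obtain ⟨-, -, m, β, c, -, h0, h1, -, rfl, hT⟩ := h
  have hex : ∃ j, z < β j := ⟨m, h1 ▸ hz.2⟩
  classical
  obtain ⟨j, hj⟩ : ∃ j, Nat.find hex = j + 1 := by
    refine Nat.exists_eq_succ_of_ne_zero fun h => ?_
    have := Nat.find_spec hex
    rw [h, h0] at this
    exact this.not_ge hz.1
  have hzj : z < β (j + 1) := hj ▸ Nat.find_spec hex
  have hjz : β j ≤ z := not_lt.1 (Nat.find_min hex (by omega))
  have hjm : j + 1 ≤ m := hj ▸ Nat.find_min' hex (h1 ▸ hz.2)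
  refine ⟨β (j + 1), hzj, ?_, fun y hy => ?_⟩
  · rcases hjm.eq_or_lt with he | hlt
    · exact Or.inl (he ▸ h1)
    · exact Or.inr ⟨j + 1, by omega, hlt, rfl⟩
  · rw [hT j hjm y ⟨hjz.trans hy.1, hy.2⟩, hT j hjm z ⟨hjz, hzj⟩]
    ring

lemma iterate_mem (h : IsIET T D) {z : ℝ} (hz : z ∈ Ico (0 : ℝ) 1) (n : ℕ) :
    T^[n] z ∈ Ico (0 : ℝ) 1 :=
  h.1.mapsTo.iterate n hz

/-- Every iterate is locally a translation to the right of each point. -/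
lemma exists_iterate_translation (h : IsIET T D) {z : ℝ} (hz : z ∈ Ico (0 : ℝ) 1) (n : ℕ) :
    ∃ δ > 0, ∀ y ∈ Ico z (z + δ), T^[n] y = y + (T^[n] z - z) := by
  induction n with
  | zero => exact ⟨1, one_pos, fun y _ => by simp⟩
  | succ n ih =>
    obtain ⟨δ, hδ, hn⟩ := ih
    obtain ⟨w, hw, -, hT⟩ := h.exists_translation (h.iterate_mem hz n)
    refine ⟨min δ (w - T^[n] z), lt_min hδ (sub_pos.2 hw), fun y hy => ?_⟩
    have h1 := min_le_left δ (w - T^[n] z)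
    have h2 := min_le_right δ (w - T^[n] z)
    have hyn := hn y ⟨hy.1, by linarith [hy.2]⟩
    rw [Function.iterate_succ_apply', Function.iterate_succ_apply',
      hT _ ⟨by linarith [hy.1], by linarith [hy.2]⟩, hyn]
    ring

/-- An iterate of an interval exchange is a translation on any interval whose interior avoids the
preimages of the discontinuities under the smaller iterates. -/
lemma iterate_eq_add (h : IsIET T D) {p q : ℝ} (hp : 0 ≤ p) (hq : q ≤ 1) {n : ℕ}
    (havoid : ∀ i < n, ∀ y ∈ Ioo p q, T^[i] y ∉ D) {y : ℝ} (hy : y ∈ Ico p q) :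
    T^[n] y = y + (T^[n] p - p) := by
  induction n generalizing y with
  | zero => simp
  | succ n ih =>
    have ih' := @ih fun i hi => havoid i (by omega)
    have hp1 : p ∈ Ico (0 : ℝ) 1 := ⟨hp, (hy.1.trans_lt hy.2).trans_le hq⟩
    obtain ⟨w, hw, hwD, hT⟩ := h.exists_translation (h.iterate_mem hp1 n)
    have hyn := ih' hy
    have hyw : T^[n] y < w := by
      rcases hwD with rfl | hwD
      · exact (h.iterate_mem ⟨hp.trans hy.1, hy.2.trans_le hq⟩ n).2
      · by_contra! hle
        have hmem : w - (T^[n] p - p) ∈ Ioo p q := ⟨by linarith, by linarith [hy.2]⟩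
        apply havoid n (by omega) _ hmem
        rw [ih' ⟨hmem.1.le, hmem.2⟩, sub_add_cancel]
        exact hwD
    rw [Function.iterate_succ_apply', Function.iterate_succ_apply',
      hT _ ⟨by linarith [hy.1], hyw⟩, hyn]
    ring

/-- An ergodic interval exchange transformation has no periodic points. -/
lemma iterate_ne_self (h : IsIET T D) (hErg : Ergodic T (volume.restrict (Ico (0 : ℝ) 1)))
    {z : ℝ} (hz : z ∈ Ico (0 : ℝ) 1) {d : ℕ} (hd : 0 < d) : T^[d] z ≠ z := by
  intro hper
  obtain ⟨δ, hδ, hT⟩ := h.exists_iterate_translation hz d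
  have hd' : (0 : ℝ) < d := by exact_mod_cast hd
  obtain ⟨ε, hε, hεlt⟩ := exists_between (lt_min hδ (lt_min (sub_pos.2 hz.2)
    (show (0 : ℝ) < 1 / d by positivity)))
  rw [lt_min_iff, lt_min_iff, lt_div_iff₀ hd'] at hεlt
  obtain ⟨hεδ, hεz, hεd⟩ := hεlt
  set μ := volume.restrict (Ico (0 : ℝ) 1) with hμ
  set J := Ico z (z + ε) with hJ
  have hJm : MeasurableSet J := measurableSet_Ico
  have hμJ : μ J = ENNReal.ofReal ε := by
    rw [hμ, Measure.restrict_eq_self _ (Ico_subset_Ico hz.1 (by linarith)), Real.volume_Ico,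
      add_sub_cancel_left]
  set S := ⋃ i ∈ Finset.range d, T^[i] ⁻¹' J with hS
  have hSm : MeasurableSet S :=
    Finset.measurableSet_biUnion _ fun i _ => (hErg.measurable.iterate i) hJm
  have hinv : S ⊆ T ⁻¹' S := by
    intro y hy
    simp only [hS, mem_iUnion, mem_preimage, Finset.mem_range] at hy ⊢
    obtain ⟨i, hi, hy⟩ := hy
    rcases i with _ | i
    · refine ⟨d - 1, by omega, ?_⟩
      have hy : y ∈ J := hy
      rw [← Function.iterate_succ_apply, Nat.sub_one, Nat.succ_pred_eq_of_pos hd,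
        hT y ⟨hy.1, by linarith [hy.2]⟩, hper, sub_self, add_zero]
      exact hy
    · exact ⟨i, by omega, hy⟩
  have hJS : J ⊆ S := fun y hy => mem_biUnion (Finset.mem_coe.2 (Finset.mem_range.2 hd)) hy
  have hSle : μ S < 1 := by
    calc μ S ≤ ∑ i ∈ Finset.range d, μ (T^[i] ⁻¹' J) := measure_biUnion_finset_le _ _
      _ = ENNReal.ofReal (ε * d) := by
        simp_rw [(hErg.toMeasurePreserving.iterate _).measure_preimage hJm.nullMeasurableSet, hμJ]
        rw [Finset.sum_const, Finset.card_range, nsmul_eq_mul, mul_comm,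
          ENNReal.ofReal_mul hε.le, ENNReal.ofReal_natCast]
      _ < 1 := ENNReal.ofReal_lt_one.2 hεd
  rcases hErg.ae_empty_or_univ_of_ae_le_preimage hSm.nullMeasurableSet
    (LE.le.eventuallyLE hinv) with h0 | h1
  · have : μ S = 0 := by rw [measure_congr h0, measure_empty]
    have hle := measure_mono (μ := μ) hJS
    rw [this, hμJ] at hle
    exact (ENNReal.ofReal_pos.2 hε).not_ge hle
  · rw [measure_congr h1, hμ, Measure.restrict_apply_univ, Real.volume_Ico] at hSle
    simp at hSle

/-- If the preimages of `D` up to time `n` are `s`-separated, the points hitting the ball of radius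
`s` about `x₀ ∈ D` between times `1` and `n` have measure at least `(n - 1) * s`. -/
lemma le_measure_hit (h : IsIET T D) (hErg : Ergodic T (volume.restrict (Ico (0 : ℝ) 1)))
    {x₀ s : ℝ} (hx₀ : x₀ ∈ D) (hs : 0 < s) (n : ℕ)
    (hsep : ∀ p ∈ ⋃ i ∈ Finset.range (n + 1), T^[i] ⁻¹' D,
      ∀ q ∈ ⋃ i ∈ Finset.range (n + 1), T^[i] ⁻¹' D, p ≠ q → s ≤ |p - q|) :
    ENNReal.ofReal ((n - 1) * s) ≤ volume.restrict (Ico (0 : ℝ) 1)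
      {y | ∃ j, 0 < j ∧ j ≤ n ∧ T^[j] y ∈ ball x₀ s} := by
  have hx := h.subset_Ico hx₀
  have hpre : ∀ j, ∃ p ∈ Ico (0 : ℝ) 1, T^[j] p = x₀ := fun j => (h.1.iterate j).surjOn hx
  choose p hp hpx using hpre
  have hmem : ∀ i ≤ n, ∀ y, T^[i] y ∈ D → y ∈ ⋃ i ∈ Finset.range (n + 1), T^[i] ⁻¹' D :=
    fun i hi y hy => mem_biUnion (Finset.mem_coe.2 (Finset.mem_range.2 (by omega))) hy
  have hpmem : ∀ i ≤ n, p i ∈ ⋃ i ∈ Finset.range (n + 1), T^[i] ⁻¹' D :=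
    fun i hi => hmem i hi _ (by rw [hpx]; exact hx₀)
  have hlt : ∀ i j, i < j → p i ≠ p j := by
    intro i j hij heq
    refine h.iterate_ne_self hErg hx (Nat.sub_pos_of_lt hij) ?_
    nth_rewrite 1 [← hpx i]
    rw [← Function.iterate_add_apply, Nat.sub_add_cancel hij.le, heq, hpx]
  have hne : ∀ i j, i ≠ j → p i ≠ p j := fun i j hij =>
    hij.lt_or_gt.elim (hlt i j) fun hji => (hlt j i hji).symm
  have hdist : ∀ i ≤ n, ∀ j ≤ n, i ≠ j → s ≤ |p i - p j| := fun i hi j hj hij =>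
    hsep _ (hpmem i hi) _ (hpmem j hj) (hne i j hij)
  set G := (Finset.Icc 1 n).filter fun j => p j + s ≤ 1 with hG
  have hcard : n ≤ G.card + 1 := by
    have hbad : ((Finset.Icc 1 n).filter fun j => ¬ p j + s ≤ 1).card ≤ 1 := by
      refine Finset.card_le_one.2 fun i hi j hj => ?_
      simp only [Finset.mem_filter, Finset.mem_Icc, not_le] at hi hj
      by_contra hij
      refine (hdist i hi.1.2 j hj.1.2 hij).not_gt (abs_lt.2 ⟨?_, ?_⟩) <;>
        linarith [(hp i).2, (hp j).2]
    have : G.card + ((Finset.Icc 1 n).filter fun j => ¬ p j + s ≤ 1).card =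
        (Finset.Icc 1 n).card :=
      Finset.card_filter_add_card_filter_not _
    rw [Nat.card_Icc] at this
    omega
  have hdisj : PairwiseDisjoint (G : Set ℕ) fun j => Ico (p j) (p j + s) := by
    intro i hi j hj hij
    simp only [hG, Finset.coe_filter, Finset.mem_Icc, mem_ofPred_eq] at hi hj
    refine Set.disjoint_left.2 fun y hyi hyj => ?_
    refine (hdist i hi.1.2 j hj.1.2 hij).not_gt (abs_lt.2 ⟨?_, ?_⟩) <;>
      linarith [hyi.1, hyi.2, hyj.1, hyj.2]
  have hsub : (⋃ j ∈ G, Ico (p j) (p j + s)) ⊆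
      {y | ∃ j, 0 < j ∧ j ≤ n ∧ T^[j] y ∈ ball x₀ s} := by
    refine iUnion₂_subset fun j hj y hy => ?_
    simp only [hG, Finset.mem_filter, Finset.mem_Icc] at hj
    refine ⟨j, hj.1.1, hj.1.2, ?_⟩
    rw [h.iterate_eq_add (hp j).1 hj.2 _ hy, hpx, mem_ball, Real.dist_eq, abs_lt]
    · constructor <;> linarith [hy.1, hy.2]
    · intro i hi q hq hqD
      refine (hsep _ (hmem i (by omega) q hqD) _ (hpmem j hj.1.2) hq.1.ne').not_gt (abs_lt.2 ?_)
      constructor <;> linarith [hq.1, hq.2]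
  calc ENNReal.ofReal ((n - 1) * s) ≤ ENNReal.ofReal (G.card * s) := by
        refine ENNReal.ofReal_le_ofReal (mul_le_mul_of_nonneg_right ?_ hs.le)
        have : (n : ℝ) ≤ G.card + 1 := by exact_mod_cast hcard
        linarith
    _ = ∑ j ∈ G, volume (Ico (p j) (p j + s)) := by
        simp only [Real.volume_Ico, add_sub_cancel_left, Finset.sum_const, nsmul_eq_mul]
        rw [ENNReal.ofReal_mul (Nat.cast_nonneg _), ENNReal.ofReal_natCast]
    _ = volume (⋃ j ∈ G, Ico (p j) (p j + s)) :=
        (measure_biUnion_finset hdisj fun _ _ => measurableSet_Ico).symm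
    _ = volume.restrict (Ico (0 : ℝ) 1) (⋃ j ∈ G, Ico (p j) (p j + s)) := by
        refine (Measure.restrict_eq_self _ (iUnion₂_subset fun j hj => ?_)).symm
        exact Ico_subset_Ico (hp j).1 (Finset.mem_filter.1 hj).2
    _ ≤ _ := measure_mono hsub

end IsIET

/-- A limsup of measurable sets of measure at least `c > 0` has positive measure. -/
lemma measure_frequently_ne_zero {α : Type*} [MeasurableSpace α] {μ : Measure α}
    [IsFiniteMeasure μ] {E : ℕ → Set α} (hE : ∀ k, MeasurableSet (E k)) {c : ENNReal}
    (hc : c ≠ 0) (h : ∀ᶠ k in atTop, c ≤ μ (E k)) : μ {x | ∃ᶠ k in atTop, x ∈ E k} ≠ 0 := by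
  set G : ℕ → Set α := fun K => ⋃ k ≥ K, E k with hG
  have hGanti : Antitone G := fun K L hKL => biUnion_mono (fun k hk => le_trans hKL hk)
    fun _ _ => Subset.rfl
  have hset : {x | ∃ᶠ k in atTop, x ∈ E k} = ⋂ K, G K := by
    ext x
    simp [hG, frequently_atTop]
  have ht := tendsto_measure_iInter_atTop (μ := μ) (s := G)
    (fun K => (MeasurableSet.iUnion fun k => MeasurableSet.iUnion fun _ => hE k).nullMeasurableSet)
    hGanti ⟨0, measure_ne_top _ _⟩
  rw [hset]
  refine ((pos_iff_ne_zero.2 hc).trans_le (ge_of_tendsto ht ?_)).ne'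
  filter_upwards [h] with K hK
  exact hK.trans (measure_mono (subset_biUnion_of_mem (u := E) (le_refl K)))

/-- For a map preserving `volume` on `[0,1)`, almost every lower hitting-time indicator is at
least `1`. -/
lemma ae_one_le_Rlow {T : ℝ → ℝ}
    (hT : MeasurePreserving T (volume.restrict (Ico (0 : ℝ) 1)) (volume.restrict (Ico (0 : ℝ) 1)))
    (x₀ : ℝ) : ∀ᵐ y ∂(volume.restrict (Ico (0 : ℝ) 1)), 1 ≤ Rlow T y x₀ := by
  set μ := volume.restrict (Ico (0 : ℝ) 1) with hμ
  have hne : ∀ᵐ y ∂μ, ∀ n : ℕ, T^[n] y ≠ x₀ := by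
    refine ae_all_iff.2 fun n => ?_
    have : ∀ᵐ y ∂μ, y ≠ x₀ := by simp [ae_iff]
    exact (hT.iterate n).quasiMeasurePreserving.ae this
  have hfar : ∀ N : ℕ, ∀ᵐ y ∂μ, ∀ᶠ n : ℕ in atTop,
      (n : ℝ) ^ (-(1 + 1 / ((N : ℝ) + 1))) ≤ dist (T^[n] y) x₀ := by
    intro N
    set b : ℝ := 1 + 1 / ((N : ℝ) + 1) with hb
    have hb1 : 1 < b := by
      have : 0 < 1 / ((N : ℝ) + 1) := by positivity
      linarith
    have hsum : Summable fun n : ℕ => 2 * (n : ℝ) ^ (-b) :=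
      (Real.summable_nat_rpow.2 (by linarith)).mul_left 2
    have hle : ∀ n : ℕ, μ (T^[n] ⁻¹' ball x₀ ((n : ℝ) ^ (-b))) ≤
        ENNReal.ofReal (2 * (n : ℝ) ^ (-b)) := fun n => by
      rw [(hT.iterate n).measure_preimage measurableSet_ball.nullMeasurableSet]
      exact (Measure.restrict_apply_le _ _).trans (Real.volume_ball _ _).le
    have hfin : (∑' n : ℕ, μ (T^[n] ⁻¹' ball x₀ ((n : ℝ) ^ (-b)))) ≠ ⊤ :=
      ne_top_of_le_ne_top hsum.tsum_ofReal_ne_top (ENNReal.tsum_le_tsum hle)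
    filter_upwards [ae_eventually_notMem hfin] with y hy
    filter_upwards [hy] with n hn
    simpa [mem_preimage, mem_ball] using hn
  filter_upwards [hne, ae_all_iff.2 hfar] with y hy hyfar
  have hN : ∀ N : ℕ, ((1 / (1 + 1 / ((N : ℝ) + 1)) : ℝ) : EReal) ≤ Rlow T y x₀ := fun N =>
    one_div_le_Rlow (by positivity) (fun n _ => hy n) (hyfar N)
  have hlim : Tendsto (fun N : ℕ => 1 / (1 + 1 / ((N : ℝ) + 1))) atTop (nhds 1) := by
    have := (tendsto_one_div_add_atTop_nhds_zero_nat (𝕜 := ℝ)).const_add 1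
    simpa using this.inv₀ (by norm_num)
  exact le_of_tendsto' ((continuous_coe_real_ereal.tendsto 1).comp hlim) hN

/-- for an ergodic IET satisfying Boshernitzan's property, the lower
    hitting-time indicator towards any discontinuity point equals `1` for a.e. `y`. -/
theorem iet_Rlow_eq_one (T : ℝ → ℝ) (D : Set ℝ) (hIET : IsIET T D)
    (hErg : Ergodic T (MeasureTheory.volume.restrict (Set.Ico (0 : ℝ) 1)))
    (C : ℝ) (hC : 0 < C) (nk : ℕ → ℕ) (hmono : StrictMono nk) (hpos : ∀ k, 0 < nk k)
    (hBos : ∀ k, ∀ p ∈ ⋃ i ∈ Finset.range (nk k + 1), T^[i] ⁻¹' D,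
      ∀ q ∈ ⋃ i ∈ Finset.range (nk k + 1), T^[i] ⁻¹' D,
        p ≠ q → C / nk k ≤ |p - q|) :
    ∀ x₀ ∈ D, ∀ᵐ y ∂(MeasureTheory.volume.restrict (Set.Ico (0 : ℝ) 1)),
      Rlow T y x₀ = 1 := by
  intro x₀ hx₀
  set μ := volume.restrict (Ico (0 : ℝ) 1) with hμ
  have hmeas : ∀ N k, MeasurableSet
      {y | ∃ j, 0 < j ∧ j ≤ nk k + N ∧ T^[j] y ∈ ball x₀ (C / nk k)} := fun N k => by
    have : {y | ∃ j, 0 < j ∧ j ≤ nk k + N ∧ T^[j] y ∈ ball x₀ (C / nk k)} =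
        ⋃ j ∈ Finset.Icc 1 (nk k + N), T^[j] ⁻¹' ball x₀ (C / nk k) := by
      ext y
      simp [Nat.succ_le_iff, and_assoc]
    rw [this]
    exact Finset.measurableSet_biUnion _ fun j _ => (hErg.measurable.iterate j) measurableSet_ball
  set A : ℕ → Set ℝ := fun N => {y | ∃ᶠ k in atTop,
    y ∈ {y | ∃ j, 0 < j ∧ j ≤ nk k + N ∧ T^[j] y ∈ ball x₀ (C / nk k)}} with hA
  have hAm : ∀ N, MeasurableSet (A N) := fun N => by
    have : A N = ⋂ K, ⋃ k ≥ K,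
        {y | ∃ j, 0 < j ∧ j ≤ nk k + N ∧ T^[j] y ∈ ball x₀ (C / nk k)} := by
      ext y
      simp [hA, frequently_atTop]
    rw [this]
    exact MeasurableSet.iInter fun K => MeasurableSet.iUnion fun k => MeasurableSet.iUnion
      fun _ => hmeas N k
  have hA0 : μ (A 0) ≠ 0 := by
    refine measure_frequently_ne_zero (hmeas 0) (c := ENNReal.ofReal (C / 2))
      (ENNReal.ofReal_pos.2 (by positivity)).ne' ?_
    filter_upwards [hmono.tendsto_atTop.eventually_ge_atTop 2] with k hk
    have hk' : (2 : ℝ) ≤ nk k := by exact_mod_cast hk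
    refine le_trans (ENNReal.ofReal_le_ofReal ?_)
      (hIET.le_measure_hit hErg hx₀ (div_pos hC (by linarith)) (nk k) (hBos k))
    rw [← mul_div_assoc, le_div_iff₀ (by linarith)]
    nlinarith
  have hinv : T ⁻¹' (⋃ N, A N) ⊆ ⋃ N, A N := by
    intro y hy
    simp only [mem_preimage, mem_iUnion] at hy ⊢
    obtain ⟨N, hN⟩ := hy
    refine ⟨N + 1, Frequently.mono hN ?_⟩
    rintro k ⟨j, -, hj, hb⟩
    exact ⟨j + 1, by omega, by omega, hb⟩
  have hfull : ∀ᵐ y ∂μ, y ∈ ⋃ N, A N := by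
    rcases hErg.ae_empty_or_univ_of_preimage_ae_le (MeasurableSet.iUnion hAm).nullMeasurableSet
      (LE.le.eventuallyLE hinv) with h0 | h1
    · refine absurd (measure_mono_null (subset_iUnion A 0) ?_) hA0
      rw [measure_congr h0, measure_empty]
    · exact eventuallyEq_univ.1 h1
  filter_upwards [hfull, ae_one_le_Rlow hErg.toMeasurePreserving x₀] with y hy hy1
  obtain ⟨N, hN⟩ := mem_iUnion.1 hy
  exact le_antisymm (Rlow_le_one hC hmono.tendsto_atTop N hN) hy1
end

section
/- Let (X,𝔅,μ) be a probability space and T : X → X an invertible measure-preserving transformation. Let Z be a finite measurable partition of X admitting a weak Bernoulli gap function N : (0,∞) → ℕ, and let A be a union of atoms of Z with m := μ(X∖A) satisfying 0 < m < 1. Set ε(j) = 1/j² − 1/(j+1)² for j ≥ 1 and n_i = Σ_{j=1}^{i} N(ε(j)). Then for every i ≥ 2, μ({x ∈ X : T^k(x) ∉ A for all 0 ≤ k ≤ n_i}) ≤ m^{⌊i/2⌋}/(1−m) + 4/i². -/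
open MeasureTheory

/-- The cylinder set `⋂_{i=t}^{t+s} T^{-i} Z_{ω(i-t)}`, an atom of the refinement
    `⋁_{i=t}^{t+s} T^{-i} Z` of the finite partition `Z`. -/
def cylinder {X ι : Type*} (T : X → X) (Z : ι → Set X) (t s : ℕ)
    (ω : Fin (s + 1) → ι) : Set X :=
  ⋂ j : Fin (s + 1), T^[t + (j : ℕ)] ⁻¹' Z (ω j)

/-- `D(P,Q) = Σ_{P,Q} |μ(P∩Q) − μ(P)μ(Q)|` for two finite indexed families of sets. -/
noncomputable def Dsum {X : Type*} [MeasurableSpace X] (μ : Measure X)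
    {ι κ : Type*} [Fintype ι] [Fintype κ] (P : ι → Set X) (Q : κ → Set X) : ℝ :=
  ∑ i : ι, ∑ j : κ,
    |(μ (P i ∩ Q j)).toReal - (μ (P i)).toReal * (μ (Q j)).toReal|

/-- `N` is a weak Bernoulli gap function for the finite partition `Z` (w.r.t. `T` and `μ`):
    for every `ε > 0`, all `s, k ≥ 0` and all `t ≥ s + N(ε)`,
    `D(P_s(Z), Q_{t,k}(Z)) < ε` where `P_s(Z) = ⋁_{i=0}^{s} T^{-i}Z` and
    `Q_{t,k}(Z) = ⋁_{i=t}^{t+k} T^{-i}Z`. -/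
def IsWBGap {X : Type*} [MeasurableSpace X] (μ : Measure X) (T : X → X)
    {ι : Type*} [Fintype ι] (Z : ι → Set X) (N : ℝ → ℕ) : Prop :=
  ∀ ε : ℝ, 0 < ε → ∀ s k t : ℕ, s + N ε ≤ t →
    Dsum μ (cylinder T Z 0 s) (cylinder T Z t k) < ε

/-- The function `T^i` for `i : ℤ`, where `S` is the inverse of `T`:
    `T^[i]` for `i ≥ 0` and `S^[|i|]` for `i < 0`. -/
def zIter {X : Type*} (T S : X → X) (i : ℤ) : X → X :=
  if 0 ≤ i then T^[i.toNat] else S^[(-i).toNat]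

theorem measurableSet_cylinder {X ι : Type*} [MeasurableSpace X] {T : X → X} (hT : Measurable T)
    {Z : ι → Set X} (hZm : ∀ i, MeasurableSet (Z i)) (t n : ℕ) (ω : Fin (n + 1) → ι) :
    MeasurableSet (cylinder T Z t n ω) :=
  MeasurableSet.iInter fun j => (hT.iterate _) (hZm (ω j))

theorem pairwise_disjoint_cylinder {X ι : Type*} (T : X → X) {Z : ι → Set X}
    (hZdisj : Pairwise (Function.onFun Disjoint Z)) (t n : ℕ) :
    Pairwise (Function.onFun Disjoint (cylinder T Z t n)) := by
  intro ω ω' h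
  obtain ⟨j, hj⟩ := Function.ne_iff.mp h
  refine Set.disjoint_left.mpr fun x hx hx' => ?_
  exact Set.disjoint_left.mp (hZdisj hj) (Set.mem_iInter.mp hx j) (Set.mem_iInter.mp hx' j)

open Classical in
/-- The set of points avoiding a union of atoms of `Z` during a time window is a union of
cylinders over that window. -/
theorem setOf_avoiding_eq_biUnion_cylinder {X ι : Type*} [Fintype ι] (T : X → X) {Z : ι → Set X}
    (hZdisj : Pairwise (Function.onFun Disjoint Z)) (hZcover : ⋃ i, Z i = Set.univ)
    (s : Finset ι) (t n : ℕ) :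
    {x : X | ∀ k ≤ n, T^[t + k] x ∉ ⋃ i ∈ s, Z i} =
      ⋃ ω ∈ Finset.univ.filter fun ω : Fin (n + 1) → ι => ∀ j, ω j ∉ s, cylinder T Z t n ω := by
  ext x
  simp only [Set.mem_ofPred_eq, Set.mem_iUnion, Finset.mem_filter, Finset.mem_univ, true_and,
    exists_prop, _root_.cylinder, Set.mem_iInter, Set.mem_preimage, not_exists, not_and]
  constructor
  · intro h
    have hex : ∀ y, ∃ i, y ∈ Z i := fun y => Set.mem_iUnion.mp (hZcover ▸ Set.mem_univ y)
    choose c hc using hex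
    refine ⟨fun j => c (T^[t + (j : ℕ)] x), fun j hj => ?_, fun j => hc _⟩
    exact h j (Nat.lt_succ_iff.mp j.isLt) _ hj (hc _)
  · rintro ⟨ω, hω, hx⟩ k hk i hi hxi
    have hxk := hx ⟨k, Nat.lt_succ_of_le hk⟩
    have hne : i ≠ ω ⟨k, Nat.lt_succ_of_le hk⟩ := by
      rintro rfl
      exact hω _ hi
    exact Set.disjoint_left.mp (hZdisj hne) hxi hxk

/-- `Dsum` bounds the correlation of unions of members of two disjoint measurable families. -/
theorem measure_biUnion_inter_biUnion_le_add_Dsum {X : Type*} [MeasurableSpace X] (μ : Measure X)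
    [IsFiniteMeasure μ] {ι κ : Type*} [Fintype ι] [Fintype κ] {P : ι → Set X} {Q : κ → Set X}
    (hPm : ∀ i, MeasurableSet (P i)) (hPd : Pairwise (Function.onFun Disjoint P))
    (hQm : ∀ j, MeasurableSet (Q j)) (hQd : Pairwise (Function.onFun Disjoint Q))
    (I : Finset ι) (J : Finset κ) :
    μ.real ((⋃ i ∈ I, P i) ∩ ⋃ j ∈ J, Q j) ≤
      μ.real (⋃ i ∈ I, P i) * μ.real (⋃ j ∈ J, Q j) + Dsum μ P Q := by
  have hsub : μ.real ((⋃ i ∈ I, P i) ∩ ⋃ j ∈ J, Q j) ≤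
      ∑ i ∈ I, ∑ j ∈ J, μ.real (P i ∩ Q j) := by
    have hset : (⋃ i ∈ I, P i) ∩ (⋃ j ∈ J, Q j) = ⋃ i ∈ I, ⋃ j ∈ J, P i ∩ Q j := by
      ext x
      simp only [Set.mem_inter_iff, Set.mem_iUnion, exists_prop]
      tauto
    rw [hset]
    exact (measureReal_biUnion_finset_le _ _).trans
      (Finset.sum_le_sum fun i _ => measureReal_biUnion_finset_le _ _)
  rw [measureReal_biUnion_finset (fun i _ i' _ h => hPd h) fun i _ => hPm i,
    measureReal_biUnion_finset (fun j _ j' _ h => hQd h) fun j _ => hQm j, Finset.sum_mul_sum]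
  refine hsub.trans ?_
  rw [← sub_le_iff_le_add', ← Finset.sum_sub_distrib]
  simp only [← Finset.sum_sub_distrib]
  calc ∑ i ∈ I, ∑ j ∈ J, (μ.real (P i ∩ Q j) - μ.real (P i) * μ.real (Q j))
      ≤ ∑ i ∈ I, ∑ j ∈ J, |μ.real (P i ∩ Q j) - μ.real (P i) * μ.real (Q j)| := by
        gcongr
        exact le_abs_self _
    _ ≤ ∑ i ∈ I, ∑ j, |μ.real (P i ∩ Q j) - μ.real (P i) * μ.real (Q j)| := by
        gcongr
        exact Finset.subset_univ J
    _ ≤ Dsum μ P Q :=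
        Finset.sum_le_sum_of_subset_of_nonneg (Finset.subset_univ I)
          fun i _ _ => Finset.sum_nonneg fun j _ => abs_nonneg _

/-- Extending the time window by a gap `N ε` multiplies the probability of avoiding `A` by at
most `μ(X∖A)`, up to an error `ε`. -/
theorem measure_avoiding_le_mul_add {X : Type*} [MeasurableSpace X] (μ : Measure X)
    [IsProbabilityMeasure μ] {T : X → X} (hpres : MeasurePreserving T μ μ)
    {ι : Type*} [Fintype ι] {Z : ι → Set X} (hZm : ∀ i, MeasurableSet (Z i))
    (hZdisj : Pairwise (Function.onFun Disjoint Z)) (hZcover : ⋃ i, Z i = Set.univ)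
    {N : ℝ → ℕ} (hN : IsWBGap μ T Z N) (s : Finset ι) {ε : ℝ} (hε : 0 < ε) {n t : ℕ}
    (hnt : n + N ε ≤ t) :
    μ.real {x : X | ∀ k ≤ t, T^[k] x ∉ ⋃ i ∈ s, Z i} ≤
      μ.real (⋃ i ∈ s, Z i)ᶜ * μ.real {x : X | ∀ k ≤ n, T^[k] x ∉ ⋃ i ∈ s, Z i} + ε := by
  classical
  have hT := hpres.measurable
  have hcor := measure_biUnion_inter_biUnion_le_add_Dsum μ
    (measurableSet_cylinder hT hZm 0 n) (pairwise_disjoint_cylinder T hZdisj 0 n)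
    (measurableSet_cylinder hT hZm t 0) (pairwise_disjoint_cylinder T hZdisj t 0)
    (Finset.univ.filter fun ω => ∀ j, ω j ∉ s) (Finset.univ.filter fun ω => ∀ j, ω j ∉ s)
  rw [← setOf_avoiding_eq_biUnion_cylinder T hZdisj hZcover,
    ← setOf_avoiding_eq_biUnion_cylinder T hZdisj hZcover] at hcor
  have hlast : {x : X | ∀ k ≤ 0, T^[t + k] x ∉ ⋃ i ∈ s, Z i} =
      T^[t] ⁻¹' (⋃ i ∈ s, Z i)ᶜ := by
    ext x
    simp
  have hmeas : MeasurableSet (⋃ i ∈ s, Z i)ᶜ :=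
    (s.measurableSet_biUnion fun i _ => hZm i).compl
  have hinv : μ.real (T^[t] ⁻¹' (⋃ i ∈ s, Z i)ᶜ) = μ.real (⋃ i ∈ s, Z i)ᶜ :=
    (hpres.iterate t).measureReal_preimage hmeas.nullMeasurableSet
  rw [hlast, hinv, mul_comm] at hcor
  simp only [zero_add] at hcor
  have hD := hN ε hε n 0 t hnt
  have hmono : μ.real {x : X | ∀ k ≤ t, T^[k] x ∉ ⋃ i ∈ s, Z i} ≤
      μ.real ({x : X | ∀ k ≤ n, T^[k] x ∉ ⋃ i ∈ s, Z i} ∩ T^[t] ⁻¹' (⋃ i ∈ s, Z i)ᶜ) :=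
    measureReal_mono fun x hx => ⟨fun k hk => hx k (by lia), hx t le_rfl⟩
  linarith

/-- A telescoping form of the discrete Gronwall inequality. -/
theorem le_pow_mul_add_sub_of_le_mul_add_sub {a b : ℕ → ℝ} {m : ℝ} (hm0 : 0 ≤ m) (hm1 : m ≤ 1)
    (hb : Antitone b) (h : ∀ i, a (i + 1) ≤ m * a i + (b i - b (i + 1))) (n k : ℕ) :
    a (n + k) ≤ m ^ k * a n + (b n - b (n + k)) := by
  induction k with
  | zero => simp
  | succ k ih =>
    have hbn : 0 ≤ b n - b (n + k) := sub_nonneg.mpr (hb (Nat.le_add_right n k))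
    calc a (n + k + 1) ≤ m * a (n + k) + (b (n + k) - b (n + k + 1)) := h _
      _ ≤ m * (m ^ k * a n + (b n - b (n + k))) + (b (n + k) - b (n + k + 1)) := by gcongr
      _ ≤ m ^ (k + 1) * a n + (b n - b (n + k + 1)) := by
        rw [pow_succ']
        linarith [mul_le_of_le_one_left hbn hm1]

/-- for a finite partition `Z` with weak Bernoulli gap function `N` and a
    union `A` of atoms of `Z` with `m = μ(X∖A) ∈ (0,1)`, setting
    `ε(j) = 1/j² − 1/(j+1)²` and `n_i = Σ_{j=1}^{i} N(ε(j))`, the measure of the set of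
    points avoiding `A` during the first `n_i` steps is at most `m^⌊i/2⌋/(1−m) + 4/i²`. -/
theorem measure_avoiding_le {X : Type*} [MeasurableSpace X] (μ : Measure X)
    [IsProbabilityMeasure μ] (T S : X → X) (hT : Measurable T) (hS : Measurable S)
    (hTS : Function.LeftInverse S T) (hST : Function.RightInverse S T)
    (hpres : MeasurePreserving T μ μ)
    {ι : Type*} [Fintype ι] (Z : ι → Set X) (hZm : ∀ i, MeasurableSet (Z i))
    (hZdisj : Pairwise (Function.onFun Disjoint Z)) (hZcover : ⋃ i, Z i = Set.univ)
    (N : ℝ → ℕ) (hN : IsWBGap μ T Z N)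
    (s : Finset ι) (A : Set X) (hA : A = ⋃ i ∈ s, Z i)
    (m : ℝ) (hm : m = (μ (Set.univ \ A)).toReal) (hm0 : 0 < m) (hm1 : m < 1)
    (nn : ℕ → ℕ)
    (hnn : ∀ i : ℕ, nn i = ∑ j ∈ Finset.Icc 1 i,
      N (1 / (j : ℝ) ^ 2 - 1 / ((j : ℝ) + 1) ^ 2)) :
    ∀ i : ℕ, 2 ≤ i →
      (μ {x : X | ∀ k : ℕ, k ≤ nn i → T^[k] x ∉ A}).toReal ≤
        m ^ (i / 2) / (1 - m) + 4 / (i : ℝ) ^ 2 := by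
  intro i hi
  subst hA
  have hm' : m = μ.real (⋃ i ∈ s, Z i)ᶜ := by
    rw [hm, Set.compl_eq_univ_sdiff, Measure.real]
  have hb : StrictAnti fun j : ℕ => 1 / ((j : ℝ) + 1) ^ 2 := by
    intro j k hjk
    have hlt : (j : ℝ) < k := by exact_mod_cast hjk
    dsimp only
    gcongr
  have hstep : ∀ j : ℕ, μ.real {x : X | ∀ k ≤ nn (j + 1), T^[k] x ∉ ⋃ i ∈ s, Z i} ≤
      m * μ.real {x : X | ∀ k ≤ nn j, T^[k] x ∉ ⋃ i ∈ s, Z i} +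
        (1 / ((j : ℝ) + 1) ^ 2 - 1 / (((j + 1 : ℕ) : ℝ) + 1) ^ 2) := by
    intro j
    rw [hm']
    refine measure_avoiding_le_mul_add μ hpres hZm hZdisj hZcover hN s
      (sub_pos.mpr (hb (Nat.lt_succ_self j))) ?_
    rw [hnn (j + 1), Finset.sum_Icc_succ_top (by lia), ← hnn j]
    push_cast
    exact le_rfl
  have hmain := le_pow_mul_add_sub_of_le_mul_add_sub
    (a := fun j => μ.real {x : X | ∀ k ≤ nn j, T^[k] x ∉ ⋃ i ∈ s, Z i}) hm0.le hm1.le hb.antitone hstep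
    (i / 2) (i - i / 2)
  rw [Nat.add_sub_of_le (Nat.div_le_self i 2)] at hmain
  have hpow : m ^ (i - i / 2) * μ.real {x : X | ∀ k ≤ nn (i / 2), T^[k] x ∉ ⋃ i ∈ s, Z i} ≤
      m ^ (i / 2) / (1 - m) :=
    calc _ ≤ m ^ (i - i / 2) := mul_le_of_le_one_right (by positivity) measureReal_le_one
      _ ≤ m ^ (i / 2) := pow_le_pow_of_le_one hm0.le hm1.le (by lia)
      _ ≤ m ^ (i / 2) / (1 - m) :=
        le_div_self (by positivity) (by linarith) (by linarith)
  have htail : 1 / (((i / 2 : ℕ) : ℝ) + 1) ^ 2 ≤ 4 / (i : ℝ) ^ 2 := by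
    have hi0 : (0 : ℝ) < i := by exact_mod_cast (by lia : 0 < i)
    have hle : (i : ℝ) ≤ 2 * (((i / 2 : ℕ) : ℝ) + 1) := by
      exact_mod_cast (by lia : i ≤ 2 * (i / 2 + 1))
    rw [div_le_div_iff₀ (by positivity) (by positivity)]
    nlinarith
  have hnonneg : 0 ≤ 1 / ((i : ℝ) + 1) ^ 2 := by positivity
  change μ.real {x : X | ∀ k ≤ nn i, T^[k] x ∉ ⋃ i ∈ s, Z i} ≤ _
  linarith
end

section
/- Let T be an interval exchange transformation of [0,1) with discontinuity set D, ergodic with respect to Lebesgue measure λ, and suppose there exist C > 0 and a strictly increasing sequence of positive integers (n_k) such that for every k, any two distinct points of the finite set ⋃_{i=0}^{n_k} T^{−i}(D) are at distance at least C/n_k. Let x₀ ∈ D be a discontinuity point, let α > 1, and let f : [0,1]∖{x₀} → [0,∞) be continuous with lim_{x→x₀} f(x)·|x−x₀|^α ∈ (0,∞). Then for λ-almost every x ∈ [0,1), the Birkhoff sums S_n(x) = Σ_{i=0}^{n} f(T^i(x)) satisfy α ≤ limsup_{n→∞} log(S_n(x))/log(n) ≤ α + 1. -/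
open Filter MeasureTheory Metric Set

/-- A polynomial upper bound on a sequence bounds its logarithmic growth exponent. -/
theorem limsup_log_div_log_le {S : ℕ → ℝ} {K b : ℝ} (hK : 1 ≤ K) (hb : 0 ≤ b)
    (h0 : ∀ n, 0 ≤ S n) (h : ∀ n : ℕ, S n ≤ K * ((n : ℝ) + 1) ^ b) :
    limsup (fun n : ℕ => ((Real.log (S n) / Real.log (n : ℝ) : ℝ) : EReal)) atTop ≤ (b : EReal) := by
  have hlog : Tendsto (fun n : ℕ => Real.log (n : ℝ)) atTop atTop :=
    Real.tendsto_log_atTop.comp tendsto_natCast_atTop_atTop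
  have htend : Tendsto (fun n : ℕ =>
      (((Real.log K + b * Real.log 2) / Real.log (n : ℝ) + b : ℝ) : EReal)) atTop
      (nhds (b : EReal)) := by
    refine (continuous_coe_real_ereal.tendsto b).comp ?_
    simpa using (hlog.const_div_atTop (Real.log K + b * Real.log 2)).add_const b
  rw [← htend.limsup_eq]
  refine limsup_le_limsup ?_
  filter_upwards [eventually_ge_atTop 2] with n hn
  have hn' : (2 : ℝ) ≤ n := by exact_mod_cast hn
  have hlogn : 0 < Real.log n := Real.log_pos (by linarith)
  have h1 : (1 : ℝ) ≤ ((n : ℝ) + 1) ^ b := Real.one_le_rpow (by linarith) hb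
  have hS : Real.log (S n) ≤ Real.log (K * ((n : ℝ) + 1) ^ b) := by
    rcases (h0 n).eq_or_lt with h2 | h2
    · rw [← h2, Real.log_zero]
      exact Real.log_nonneg (one_le_mul_of_one_le_of_one_le hK h1)
    · exact Real.log_le_log h2 (h n)
  have hn1 : Real.log ((n : ℝ) + 1) ≤ Real.log 2 + Real.log n := by
    rw [← Real.log_mul (by norm_num) (by linarith)]
    exact Real.log_le_log (by linarith) (by linarith)
  rw [Real.log_mul (by linarith) (by positivity), Real.log_rpow (by linarith)] at hS
  rw [EReal.coe_le_coe_iff, div_add' _ _ _ hlogn.ne']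
  gcongr
  nlinarith [mul_le_mul_of_nonneg_left hn1 hb]

/-- A polynomial lower bound along a subsequence bounds the logarithmic growth exponent below. -/
theorem le_limsup_log_div_log {S : ℕ → ℝ} {c a : ℝ} (hc : 0 < c)
    (h : ∃ᶠ n : ℕ in atTop, c * (n : ℝ) ^ a ≤ S n) :
    (a : EReal) ≤
      limsup (fun n : ℕ => ((Real.log (S n) / Real.log (n : ℝ) : ℝ) : EReal)) atTop := by
  by_contra! hlt
  obtain ⟨b, hb1, hb2⟩ := EReal.lt_iff_exists_real_btwn.1 hlt
  have hev := eventually_lt_of_limsup_lt hb1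
  have hlog : Tendsto (fun n : ℕ => Real.log (n : ℝ)) atTop atTop :=
    Real.tendsto_log_atTop.comp tendsto_natCast_atTop_atTop
  have htend : Tendsto (fun n : ℕ => Real.log c / Real.log (n : ℝ) + a) atTop (nhds a) := by
    simpa using (hlog.const_div_atTop (Real.log c)).add_const a
  have hev2 := htend.eventually_const_lt (EReal.coe_lt_coe_iff.1 hb2)
  obtain ⟨n, hn, hn1, hn2, hn3⟩ :=
    (h.and_eventually (hev.and (hev2.and (eventually_ge_atTop 2)))).exists
  have hn' : (2 : ℝ) ≤ n := by exact_mod_cast hn3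
  have hlogn : 0 < Real.log n := Real.log_pos (by linarith)
  have hnpos : (0 : ℝ) < n := by linarith
  have hle := Real.log_le_log (by positivity) hn
  rw [Real.log_mul hc.ne' (by positivity), Real.log_rpow hnpos] at hle
  rw [EReal.coe_lt_coe_iff, div_lt_iff₀ hlogn] at hn1
  rw [div_add' _ _ _ hlogn.ne', lt_div_iff₀ hlogn] at hn2
  linarith

/-- Reverse Borel–Cantelli bound for a finite measure. -/
theorem le_measure_frequently_mem {X : Type*} [MeasurableSpace X] {μ : Measure X}
    [IsFiniteMeasure μ] {A : ℕ → Set X} (hA : ∀ k, MeasurableSet (A k)) {c : ENNReal}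
    (h : ∀ k, c ≤ μ (A k)) : c ≤ μ {x | ∃ᶠ k in atTop, x ∈ A k} := by
  have hset : {x | ∃ᶠ k in atTop, x ∈ A k} = ⋂ N : ℕ, ⋃ k ≥ N, A k := by
    ext x
    simp [frequently_atTop]
  have hanti : Antitone fun N : ℕ => ⋃ k ≥ N, A k := fun M N hMN =>
    biUnion_subset_biUnion_left fun k (hk : N ≤ k) => hMN.trans hk
  rw [hset, hanti.measure_iInter
    (fun N => (MeasurableSet.biUnion (to_countable _) fun k _ => hA k).nullMeasurableSet)
    ⟨0, measure_ne_top _ _⟩]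
  exact le_iInf fun N => (h N).trans (measure_mono (subset_biUnion_of_mem (u := A) (le_refl N)))

/-- If the orbit segment of `[p, p + r)` of length `i` stays free of discontinuities in the
interior, then `T^[i]` acts on `[p, p + r)` as a translation. -/
theorem IsIET.iterate_eq_add_s16 {T : ℝ → ℝ} {D : Set ℝ} (hT : IsIET T D) {p r : ℝ} (hp : 0 ≤ p)
    (hpr : p + r ≤ 1) (i : ℕ) (hD : ∀ j < i, ∀ t, 0 < t → t < r → T^[j] (p + t) ∉ D) :
    ∀ t, 0 ≤ t → t < r → T^[i] (p + t) = T^[i] p + t := by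
  obtain ⟨hbij, -, m, β, c, -, hβ0, hβm, hβ, rfl, hc⟩ := hT
  induction i with
  | zero => simp
  | succ i ih =>
    intro t ht0 htr
    have ih := ih fun j hj => hD j (hj.trans i.lt_succ_self)
    have hmaps : ∀ s, 0 ≤ s → s < r → T^[i] p + s ∈ Ico (0 : ℝ) 1 := fun s hs hsr =>
      ih s hs hsr ▸ hbij.mapsTo.iterate i ⟨by linarith, by linarith⟩
    rw [Function.iterate_succ_apply', Function.iterate_succ_apply', ih t ht0 htr]
    set u := T^[i] p with hu
    have hu01 : u ∈ Ico (0 : ℝ) 1 := by simpa using hmaps 0 le_rfl (ht0.trans_lt htr)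
    obtain ⟨j, hjm, hj⟩ : ∃ j < m, u ∈ Ico (β j) (β (j + 1)) := by
      have hex : ∃ k, u < β k := ⟨m, hβm ▸ hu01.2⟩
      classical
      have h1 := Nat.find_spec hex
      have h0 : Nat.find hex ≠ 0 := fun h => by
        rw [h, hβ0] at h1; exact absurd hu01.1 (not_le.2 h1)
      obtain ⟨k, hk⟩ := Nat.exists_eq_succ_of_ne_zero h0
      have hle : Nat.find hex ≤ m := Nat.find_min' hex (hβm ▸ hu01.2)
      refine ⟨k, by omega, not_lt.1 (Nat.find_min hex (by omega)), ?_⟩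
      rw [hk] at h1
      exact h1
    have hlt : u + t < β (j + 1) := by
      by_contra! hge
      have hs0 : 0 < β (j + 1) - u := sub_pos.2 hj.2
      have hsr : β (j + 1) - u < r := by linarith
      have h1 := hmaps _ hs0.le hsr
      have h2 := hD i i.lt_succ_self _ hs0 hsr
      rw [ih _ hs0.le hsr, add_sub_cancel] at h2
      rw [add_sub_cancel] at h1
      rcases (Nat.succ_le_of_lt hjm).lt_or_eq with h3 | h3
      · exact h2 ⟨j + 1, by omega, h3, rfl⟩
      · rw [← hβm, ← h3] at h1
        exact lt_irrefl _ h1.2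
    rw [hc j hjm u hj, hc j hjm (u + t) ⟨by linarith [hj.1], hlt⟩]
    ring

/-- An ergodic map of `[0, 1)` has no iterate fixing an interval pointwise. -/
theorem Ergodic.not_forall_iterate_eq {T : ℝ → ℝ}
    (hErg : Ergodic T (volume.restrict (Ico (0 : ℝ) 1))) {k : ℕ} (hk : 0 < k) {p r : ℝ}
    (hp : 0 ≤ p) (hr : 0 < r) (hpr : p + r ≤ 1) : ¬ ∀ t, 0 ≤ t → t < r → T^[k] (p + t) = p + t := by
  intro hfix
  set μ := volume.restrict (Ico (0 : ℝ) 1) with hμ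
  have hk' : (0 : ℝ) < k := by exact_mod_cast hk
  set δ := min r (1 / (2 * k)) with hδ
  have hδ0 : 0 < δ := lt_min hr (by positivity)
  have hδr : δ ≤ r := min_le_left _ _
  set J := Ico p (p + δ)
  have hJm : MeasurableSet J := measurableSet_Ico
  have hμJ : μ J = ENNReal.ofReal δ := by
    rw [hμ, Measure.restrict_apply hJm,
      inter_eq_left.2 (Ico_subset_Ico hp (by linarith)), Real.volume_Ico, add_sub_cancel_left]
  set U := ⋃ j ∈ Finset.range k, T^[j] ⁻¹' J with hU
  have hUm : MeasurableSet U :=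
    Finset.measurableSet_biUnion _ fun j _ => hErg.measurable.iterate j hJm
  have hsub : U ⊆ T ⁻¹' U := by
    intro x hx
    simp only [hU, mem_iUnion, Finset.mem_range, mem_preimage, exists_prop] at hx ⊢
    obtain ⟨j, hj, hx⟩ := hx
    rcases j with _ | j
    · refine ⟨k - 1, by omega, ?_⟩
      rw [← Function.iterate_succ_apply, Nat.succ_eq_add_one, Nat.sub_add_cancel hk]
      have hxJ : x ∈ J := hx
      have := hfix (x - p) (by linarith [hxJ.1]) (by linarith [hxJ.2])
      rw [add_sub_cancel] at this
      rwa [this]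
    · exact ⟨j, by omega, by simpa using hx⟩
  have hJU : J ⊆ U := fun x hx => by
    simp only [hU, mem_iUnion, Finset.mem_range, mem_preimage, exists_prop]
    exact ⟨0, hk, hx⟩
  have hμU : μ U ≤ ENNReal.ofReal (1 / 2) := by
    refine (measure_biUnion_finset_le _ _).trans ?_
    simp_rw [fun j => (hErg.toMeasurePreserving.iterate j).measure_preimage hJm.nullMeasurableSet]
    rw [Finset.sum_const, Finset.card_range, nsmul_eq_mul, hμJ, ← ENNReal.ofReal_natCast,
      ← ENNReal.ofReal_mul hk'.le]
    refine ENNReal.ofReal_le_ofReal ?_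
    calc (k : ℝ) * δ ≤ k * (1 / (2 * k)) := by gcongr; exact min_le_right _ _
      _ = 1 / 2 := by field_simp
  rcases hErg.ae_empty_or_univ_of_ae_le_preimage hUm.nullMeasurableSet
    (Eventually.of_forall hsub) with h | h
  · have := (measure_mono (μ := μ) hJU).trans_eq (measure_congr h)
    rw [hμJ, measure_empty, nonpos_iff_eq_zero, ENNReal.ofReal_eq_zero] at this
    linarith
  · rw [measure_congr h, hμ, Measure.restrict_apply_univ, Real.volume_Ico] at hμU
    rw [ENNReal.ofReal_le_ofReal_iff (by norm_num)] at hμU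
    norm_num at hμU

/-- When the points of `⋃ i ≤ n, T^{-i} D` are `C / n`-separated, a definite proportion of points
comes `C / n`-close to a given aperiodic discontinuity within time `n`. -/
theorem IsIET.le_measure_iUnion_preimage {T : ℝ → ℝ} {D : Set ℝ} (hT : IsIET T D)
    {C : ℝ} (hC : 0 < C) {n : ℕ} (hn : 0 < n)
    (hsep : ∀ p ∈ ⋃ i ∈ Finset.range (n + 1), T^[i] ⁻¹' D,
      ∀ q ∈ ⋃ i ∈ Finset.range (n + 1), T^[i] ⁻¹' D, p ≠ q → C / n ≤ |p - q|)
    {x₀ : ℝ} (hx₀ : x₀ ∈ D) (hx01 : x₀ ∈ Ico (0 : ℝ) 1) (hper : ∀ k, 0 < k → T^[k] x₀ ≠ x₀) :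
    ENNReal.ofReal C ≤ volume.restrict (Ico (0 : ℝ) 1)
      (⋃ i ∈ Finset.range (n + 1), T^[i] ⁻¹' Ico x₀ (x₀ + C / n)) := by
  classical
  have hn' : (0 : ℝ) < n := by exact_mod_cast hn
  set r := C / n with hr
  have hr0 : 0 < r := by positivity
  choose q hq01 hq using fun i : ℕ => (hT.1.surjOn.iterate i) hx01
  have hqmem : ∀ i ∈ Finset.range (n + 1), q i ∈ ⋃ i ∈ Finset.range (n + 1), T^[i] ⁻¹' D := by
    intro i hi
    refine mem_biUnion hi ?_
    rw [mem_preimage, hq]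
    exact hx₀
  have hqinj : ∀ i j, i < j → q i ≠ q j := by
    intro i j hij h
    apply hper (j - i) (by omega)
    conv_lhs => rw [← hq i]
    rw [← Function.iterate_add_apply, Nat.sub_add_cancel hij.le, h, hq]
  have hqinj' : ∀ i j, i ≠ j → q i ≠ q j := fun i j hij =>
    hij.lt_or_gt.elim (hqinj i j) fun h => (hqinj j i h).symm
  set G := (Finset.range (n + 1)).filter fun i => q i + r ≤ 1 with hG
  have hcard : n ≤ G.card := by
    have hbad : ((Finset.range (n + 1)).filter fun i => ¬ q i + r ≤ 1).card ≤ 1 := by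
      rw [Finset.card_le_one]
      intro i hi j hj
      rw [Finset.mem_filter, not_le] at hi hj
      by_contra hij
      have h1 := hsep _ (hqmem i hi.1) _ (hqmem j hj.1) (hqinj' i j hij)
      have h2 : |q i - q j| < r := abs_lt.2
        ⟨by linarith [hi.2, (hq01 j).2], by linarith [hj.2, (hq01 i).2]⟩
      linarith
    have := Finset.card_filter_add_card_filter_not (s := Finset.range (n + 1))
      (fun i => q i + r ≤ 1)
    rw [Finset.card_range, ← hG] at this
    omega
  have hsub : ⋃ i ∈ G, Ico (q i) (q i + r) ⊆
      ⋃ i ∈ Finset.range (n + 1), T^[i] ⁻¹' Ico x₀ (x₀ + r) := by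
    intro x hx
    simp only [mem_iUnion, exists_prop] at hx
    obtain ⟨i, hi, hx⟩ := hx
    rw [hG, Finset.mem_filter] at hi
    refine mem_biUnion hi.1 ?_
    have key := hT.iterate_eq_add_s16 (hq01 i).1 hi.2 i (fun j hj t ht0 htr hD => ?_) (x - q i)
      (by linarith [hx.1]) (by linarith [hx.2])
    · rw [add_sub_cancel, hq] at key
      rw [mem_preimage, key]
      exact ⟨by linarith [hx.1], by linarith [hx.2]⟩
    · have hj' : j ∈ Finset.range (n + 1) := by
        have := Finset.mem_range.1 hi.1
        exact Finset.mem_range.2 (by omega)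
      have := hsep (q i + t) (mem_biUnion hj' hD) _ (hqmem i hi.1) (by linarith)
      rw [add_sub_cancel_left, abs_of_pos ht0] at this
      linarith
  have hsub1 : ⋃ i ∈ G, Ico (q i) (q i + r) ⊆ Ico (0 : ℝ) 1 := by
    refine iUnion₂_subset fun i hi => Ico_subset_Ico (hq01 i).1 ?_
    exact (Finset.mem_filter.1 hi).2
  refine le_trans ?_ (measure_mono hsub)
  rw [Measure.restrict_apply (Finset.measurableSet_biUnion _ fun _ _ => measurableSet_Ico),
    inter_eq_left.2 hsub1, measure_biUnion_finset ?_ fun _ _ => measurableSet_Ico]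
  · simp_rw [Real.volume_Ico, add_sub_cancel_left]
    rw [Finset.sum_const, nsmul_eq_mul, ← ENNReal.ofReal_natCast, ← ENNReal.ofReal_mul (by simp)]
    refine ENNReal.ofReal_le_ofReal ?_
    calc C = n * r := by rw [hr]; field_simp
      _ ≤ G.card * r := by gcongr
  · intro i hi j hj hij
    have h := hsep _ (hqmem i (Finset.mem_filter.1 hi).1) _ (hqmem j (Finset.mem_filter.1 hj).1)
      (hqinj' i j hij)
    refine Set.disjoint_left.2 fun x hxi hxj => ?_
    have : |q i - q j| < r := abs_lt.2
      ⟨by linarith [hxi.2, hxj.1], by linarith [hxj.2, hxi.1]⟩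
    linarith

/-- If the set of points coming `C / n_k`-close to `x₀` within time `n_k` has measure bounded below,
then almost every point belongs to it for infinitely many `k`. -/
theorem Ergodic.ae_frequently_exists_iterate_mem {T : ℝ → ℝ} {μ : Measure ℝ} [IsFiniteMeasure μ]
    [NullSingletonClass μ] (hErg : Ergodic T μ) {C : ℝ} {nk : ℕ → ℕ}
    (hnk : Tendsto nk atTop atTop) {x₀ : ℝ}
    {c : ENNReal} (hc : c ≠ 0)
    (hA : ∀ k, c ≤ μ (⋃ i ∈ Finset.range (nk k + 1), T^[i] ⁻¹' Ico x₀ (x₀ + C / nk k))) :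
    ∀ᵐ x ∂μ, ∃ᶠ k in atTop,
      x ∈ ⋃ i ∈ Finset.range (nk k + 1), T^[i] ⁻¹' Ico x₀ (x₀ + C / nk k) := by
  set A : ℕ → Set ℝ :=
    fun k => ⋃ i ∈ Finset.range (nk k + 1), T^[i] ⁻¹' Ico x₀ (x₀ + C / nk k) with hAdef
  have hAm : ∀ k, MeasurableSet (A k) := fun k =>
    Finset.measurableSet_biUnion _ fun i _ => hErg.measurable.iterate i measurableSet_Ico
  set B := {x | ∃ᶠ k in atTop, x ∈ A k} with hB
  have hBm : MeasurableSet B := by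
    have hlimsup : B = limsup A atTop := by
      ext x
      simp [hB, limsup_eq_iInf_iSup_of_nat, frequently_atTop]
    exact hlimsup ▸ MeasurableSet.measurableSet_limsup hAm
  have hBc : c ≤ μ B := le_measure_frequently_mem hAm hA
  have hle : B ≤ᵐ[μ] T ⁻¹' B := by
    have hne : ∀ᵐ x ∂μ, x ≠ x₀ := by simp [ae_iff]
    filter_upwards [hne] with x hx hxB
    have hxB' : ∃ᶠ k in atTop, x ∈ A k := hxB
    have hsmall : ∀ᶠ k in atTop, x ∉ Ico x₀ (x₀ + C / nk k) := by
      rcases lt_or_gt_of_ne hx with h | h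
      · exact Eventually.of_forall fun k hk => absurd hk.1 (not_le.2 h)
      · have ht : Tendsto (fun k => C / (nk k : ℝ)) atTop (nhds 0) :=
          (tendsto_natCast_atTop_atTop.comp hnk).const_div_atTop C
        filter_upwards [ht.eventually_lt_const (sub_pos.2 h)] with k hk hk'
        linarith [hk'.2]
    refine (hxB'.and_eventually hsmall).mono ?_
    rintro k ⟨hk, hk'⟩
    simp only [hAdef, mem_iUnion, Finset.mem_range, mem_preimage, exists_prop] at hk ⊢
    obtain ⟨i, hi, hk⟩ := hk
    rcases i with _ | i
    · exact absurd hk hk'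
    · exact ⟨i, by omega, by simpa using hk⟩
  rcases hErg.ae_empty_or_univ_of_ae_le_preimage hBm.nullMeasurableSet hle with h | h
  · rw [measure_congr h, measure_empty, nonpos_iff_eq_zero] at hBc
    exact absurd hBc hc
  · exact h.mem_iff.mono fun x hx => hx.2 trivial

/-- Borel–Cantelli: orbits approach a point no faster than `n ^ (-s)` for `s > 1`. -/
theorem ae_eventually_rpow_le_abs_iterate_sub {T : ℝ → ℝ} {E : Set ℝ}
    (hT : MeasurePreserving T (volume.restrict E) (volume.restrict E)) (x₀ : ℝ) {s : ℝ}
    (hs : 1 < s) :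
    ∀ᵐ x ∂(volume.restrict E), ∀ᶠ i : ℕ in atTop, ((i : ℝ) + 1) ^ (-s) ≤ |T^[i] x - x₀| := by
  have hsum : Summable fun i : ℕ => 2 * ((i : ℝ) + 1) ^ (-s) := by
    refine Summable.mul_left 2 ?_
    have := (summable_nat_add_iff 1).2 (Real.summable_nat_rpow.2 (show -s < -1 by linarith))
    simpa using this
  have hbd : ∀ i : ℕ, volume.restrict E (T^[i] ⁻¹' ball x₀ (((i : ℝ) + 1) ^ (-s))) ≤
      ENNReal.ofReal (2 * ((i : ℝ) + 1) ^ (-s)) := fun i => by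
    rw [(hT.iterate i).measure_preimage measurableSet_ball.nullMeasurableSet, ← Real.volume_ball]
    exact Measure.restrict_apply_le _ _
  have hfin : ∑' i : ℕ, volume.restrict E (T^[i] ⁻¹' ball x₀ (((i : ℝ) + 1) ^ (-s))) ≠ ⊤ :=
    ne_top_of_le_ne_top hsum.tsum_ofReal_ne_top (ENNReal.tsum_le_tsum hbd)
  filter_upwards [ae_eventually_notMem hfin] with x hx
  filter_upwards [hx] with i hi
  simpa [Real.dist_eq] using hi

/-- A function with a power-type pole which is continuous elsewhere on a compact set is bounded
by a multiple of the pole. -/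
theorem exists_forall_mul_rpow_le {f : ℝ → ℝ} {E : Set ℝ} (hE : IsCompact E) {x₀ α L : ℝ}
    (hf : ContinuousOn f (E \ {x₀}))
    (hlim : Tendsto (fun z => f z * |z - x₀| ^ α) (nhdsWithin x₀ (E \ {x₀})) (nhds L)) :
    ∃ M, ∀ z ∈ E \ {x₀}, f z * |z - x₀| ^ α ≤ M := by
  have hcont : ContinuousOn (Function.update (fun z => f z * |z - x₀| ^ α) x₀ L) E := by
    rw [continuousOn_update_iff]
    refine ⟨hf.mul fun z hz => ?_, fun _ => hlim⟩
    refine ContinuousAt.continuousWithinAt ?_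
    exact ContinuousAt.rpow_const (by fun_prop) (Or.inl (abs_ne_zero.2 (sub_ne_zero.2 hz.2)))
  obtain ⟨M, hM⟩ := (hE.image_of_continuousOn hcont).bddAbove
  refine ⟨M, fun z hz => ?_⟩
  have := hM (mem_image_of_mem _ hz.1)
  rwa [Function.update_of_ne hz.2] at this

/-- for an ergodic IET with the Boshernitzan property and an observable
    with an asymptote of order `α > 1` at a discontinuity point, the Birkhoff sums
    satisfy `α ≤ limsup log S_n / log n ≤ α + 1` almost everywhere. -/
theorem iet_birkhoff_growth (T : ℝ → ℝ) (D : Set ℝ) (hIET : IsIET T D)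
    (hErg : Ergodic T (MeasureTheory.volume.restrict (Set.Ico (0 : ℝ) 1)))
    (C : ℝ) (hC : 0 < C) (nk : ℕ → ℕ) (hmono : StrictMono nk) (hpos : ∀ k, 0 < nk k)
    (hBos : ∀ k, ∀ p ∈ ⋃ i ∈ Finset.range (nk k + 1), T^[i] ⁻¹' D,
      ∀ q ∈ ⋃ i ∈ Finset.range (nk k + 1), T^[i] ⁻¹' D,
        p ≠ q → C / nk k ≤ |p - q|)
    (x₀ : ℝ) (hx₀ : x₀ ∈ D) (α : ℝ) (hα : 1 < α)
    (f : ℝ → ℝ) (hf0 : ∀ z, z ≠ x₀ → 0 ≤ f z)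
    (hfc : ContinuousOn f (Set.Icc (0 : ℝ) 1 \ {x₀})) (L : ℝ) (hL : 0 < L)
    (hlim : Filter.Tendsto (fun z => f z * |z - x₀| ^ α)
      (nhdsWithin x₀ (Set.Icc (0 : ℝ) 1 \ {x₀})) (nhds L)) :
    ∀ᵐ x ∂(MeasureTheory.volume.restrict (Set.Ico (0 : ℝ) 1)),
      (α : EReal) ≤
          Filter.limsup (fun n : ℕ =>
            ((Real.log (∑ i ∈ Finset.range (n + 1), f (T^[i] x)) / Real.log (n : ℝ) : ℝ) :
              EReal)) Filter.atTop ∧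
        Filter.limsup (fun n : ℕ =>
            ((Real.log (∑ i ∈ Finset.range (n + 1), f (T^[i] x)) / Real.log (n : ℝ) : ℝ) :
              EReal)) Filter.atTop ≤ ((α + 1 : ℝ) : EReal) := by
  set μ := volume.restrict (Ico (0 : ℝ) 1) with hμ
  have hMP := hErg.toMeasurePreserving
  have hmaps : MapsTo T (Ico 0 1) (Ico 0 1) := hIET.1.mapsTo
  have hx01 : x₀ ∈ Ioo (0 : ℝ) 1 := by
    obtain ⟨-, -, m, β, c, -, hβ0, hβm, hβ, rfl, -⟩ := hIET
    obtain ⟨j, hj1, hjm, rfl⟩ := hx₀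
    have hmono : StrictMonoOn β (Iic m) :=
      strictMonoOn_of_lt_add_one ordConnected_Iic fun a _ _ ha => hβ a (Nat.lt_of_succ_le ha)
    exact ⟨hβ0 ▸ hmono (Nat.zero_le m) hjm.le hj1, hβm ▸ hmono hjm.le (mem_Iic.2 le_rfl) hjm⟩
  have hper : ∀ k, 0 < k → T^[k] x₀ ≠ x₀ := by
    intro k hk hfix
    have hn : (0 : ℝ) < nk k := by exact_mod_cast hpos k
    have hr0 : 0 < min (C / nk k) (1 - x₀) := lt_min (by positivity) (sub_pos.2 hx01.2)
    have hr1 : x₀ + min (C / nk k) (1 - x₀) ≤ 1 := by linarith [min_le_right (C / nk k) (1 - x₀)]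
    refine hErg.not_forall_iterate_eq hk hx01.1.le hr0 hr1 fun t ht0 htr => ?_
    rw [hIET.iterate_eq_add_s16 hx01.1.le hr1 k (fun j hj t ht0 htr hD => ?_) t ht0 htr, hfix]
    have hj' : j ∈ Finset.range (nk k + 1) := by
      have := hmono.id_le k
      simp only [id_eq] at this
      exact Finset.mem_range.2 (by omega)
    have := hBos k (x₀ + t) (mem_biUnion hj' hD) x₀
      (mem_biUnion (Finset.mem_coe.2 (Finset.mem_range.2 (Nat.succ_pos _))) hx₀) (by linarith)
    rw [add_sub_cancel_left, abs_of_pos ht0] at this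
    linarith [min_le_left (C / nk k) (1 - x₀)]
  have hnk : Tendsto nk atTop atTop := hmono.tendsto_atTop
  have hclose := hErg.ae_frequently_exists_iterate_mem hnk (C := C) (x₀ := x₀)
    (c := ENNReal.ofReal C) (by simpa using hC) fun k =>
      hIET.le_measure_iUnion_preimage hC (hpos k) (hBos k) hx₀
        (Ioo_subset_Ico_self hx01) hper
  have havoid : ∀ᵐ x ∂μ, ∀ i : ℕ, T^[i] x ≠ x₀ := by
    rw [ae_all_iff]
    intro i
    have hne : ∀ᵐ x ∂μ, x ≠ x₀ := by simp [ae_iff]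
    exact (hMP.iterate i).quasiMeasurePreserving.ae hne
  obtain ⟨M, hM⟩ := exists_forall_mul_rpow_le isCompact_Icc hfc hlim
  have hfar : ∀ᵐ x ∂μ, ∀ j : ℕ, ∀ᶠ i : ℕ in atTop,
      ((i : ℝ) + 1) ^ (-(1 + 1 / ((j : ℝ) + 1))) ≤ |T^[i] x - x₀| := by
    rw [ae_all_iff]
    intro j
    exact ae_eventually_rpow_le_abs_iterate_sub hMP x₀ (lt_add_of_pos_right 1 (by positivity))
  filter_upwards [hclose, havoid, hfar, ae_restrict_mem measurableSet_Ico] with x hx hxne hxfar hx1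
  have hmem : ∀ i, T^[i] x ∈ Icc (0 : ℝ) 1 \ {x₀} := fun i =>
    ⟨Ico_subset_Icc_self (hmaps.iterate i hx1), hxne i⟩
  have hfnn : ∀ i, 0 ≤ f (T^[i] x) := fun i => hf0 _ (hxne i)
  have habs : ∀ i, 0 < |T^[i] x - x₀| := fun i => abs_pos.2 (sub_ne_zero.2 (hxne i))
  constructor
  · refine le_limsup_log_div_log (c := L / 2 * C ^ (-α)) (by positivity) ?_
    have hnear := hlim.eventually_const_lt (show L / 2 < L by linarith)
    rw [eventually_nhdsWithin_iff, Metric.eventually_nhds_iff] at hnear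
    obtain ⟨ε, hε, hnear⟩ := hnear
    have ht : Tendsto (fun k => C / (nk k : ℝ)) atTop (nhds 0) :=
      (tendsto_natCast_atTop_atTop.comp hnk).const_div_atTop C
    refine hnk.frequently ((hx.and_eventually (ht.eventually_lt_const hε)).mono ?_)
    rintro k ⟨hk, hkε⟩
    simp only [mem_iUnion, mem_preimage, exists_prop] at hk
    obtain ⟨i, hi, hk⟩ := hk
    have hn : (0 : ℝ) < nk k := by exact_mod_cast hpos k
    have hd : |T^[i] x - x₀| < C / nk k := by
      rw [abs_of_nonneg (sub_nonneg.2 hk.1)]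
      linarith [hk.2]
    have hlow := hnear (y := T^[i] x) (by rw [Real.dist_eq]; linarith) (hmem i)
    have hpow : |T^[i] x - x₀| ^ α ≤ (C / nk k) ^ α :=
      Real.rpow_le_rpow (abs_nonneg _) hd.le (by linarith)
    calc L / 2 * C ^ (-α) * (nk k : ℝ) ^ α = L / 2 / (C / nk k) ^ α := by
          rw [Real.div_rpow hC.le hn.le, Real.rpow_neg hC.le]
          field_simp
      _ ≤ f (T^[i] x) := by
          rw [div_le_iff₀ (by positivity)]
          exact hlow.le.trans (mul_le_mul_of_nonneg_left hpow (hfnn i))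
      _ ≤ ∑ i ∈ Finset.range (nk k + 1), f (T^[i] x) :=
          Finset.single_le_sum (f := fun i => f (T^[i] x)) (fun j _ => hfnn j) hi
  · have hbound : ∀ j : ℕ, limsup (fun n : ℕ =>
        ((Real.log (∑ i ∈ Finset.range (n + 1), f (T^[i] x)) / Real.log (n : ℝ) : ℝ) :
          EReal)) atTop ≤ ((1 + (1 + 1 / ((j : ℝ) + 1)) * α : ℝ) : EReal) := by
      intro j
      set s : ℝ := 1 + 1 / ((j : ℝ) + 1) with hs
      have hs0 : 0 < s := by positivity
      have hbdd : BddAbove (range fun i : ℕ => f (T^[i] x) / ((i : ℝ) + 1) ^ (s * α)) := by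
        refine IsBoundedUnder.bddAbove_range ⟨M, eventually_map.2 ?_⟩
        filter_upwards [hxfar j] with i hi
        refine le_trans ?_ (hM _ (hmem i))
        rw [div_eq_mul_inv, ← Real.rpow_neg (by positivity), ← neg_mul,
          Real.rpow_mul (by positivity)]
        exact mul_le_mul_of_nonneg_left
          (Real.rpow_le_rpow (by positivity) hi (by linarith)) (hfnn i)
      obtain ⟨K, hK⟩ := hbdd
      refine limsup_log_div_log_le (K := max K 1) (le_max_right _ _) (by positivity)
        (fun n => Finset.sum_nonneg fun i _ => hfnn i) fun n => ?_
      calc ∑ i ∈ Finset.range (n + 1), f (T^[i] x)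
          ≤ ∑ i ∈ Finset.range (n + 1), max K 1 * ((n : ℝ) + 1) ^ (s * α) := by
            refine Finset.sum_le_sum fun i hi => ?_
            have h1 := hK (mem_range_self i)
            rw [div_le_iff₀ (by positivity)] at h1
            have hin : (i : ℝ) ≤ n := by
              exact_mod_cast Nat.lt_succ_iff.1 (Finset.mem_range.1 hi)
            refine h1.trans ?_
            gcongr
            exact le_max_left _ _
        _ = max K 1 * ((n : ℝ) + 1) ^ (1 + s * α) := by
            rw [Finset.sum_const, Finset.card_range, nsmul_eq_mul,
              Real.rpow_add (by positivity), Real.rpow_one]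
            push_cast
            ring
    have htend : Tendsto (fun j : ℕ => ((1 + (1 + 1 / ((j : ℝ) + 1)) * α : ℝ) : EReal)) atTop
        (nhds ((α + 1 : ℝ) : EReal)) := by
      refine (continuous_coe_real_ereal.tendsto _).comp ?_
      have := ((tendsto_one_div_add_atTop_nhds_zero_nat (𝕜 := ℝ)).const_add 1).mul_const α
      simpa [add_comm] using this.const_add 1
    exact ge_of_tendsto' htend hbound
end
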